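/- arXiv:2409.04451 — 7 statements merged into one kernel-verified Lean document; each statement's English description precedes it below -/
import Mathlib

section
/- If N is a friend of 20, then there exist positive integers a and m such that N = 2·5^(2a)·m², where m is odd, coprime to 5, and coprime to both 3 and 7. -/
/-- `N` is a friend of `20`: `N > 20` and `σ(N)/N = 21/10`, i.e. `10·σ(N) = 21·N`. -/
def IsFriendOf20 (N : ℕ) : Prop :=
  20 < N ∧ 10 * ArithmeticFunction.sigma 1 N = 21 * N

open ArithmeticFunction in
theorem mul_sigma_one_lt_sigma_one_mul {k c : ℕ} (hk : k ≠ 0) (hc : 1 < c) :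
    c * sigma 1 k < sigma 1 (k * c) := by
  have hinj : Set.InjOn (fun d => c * d) (k.divisors : Set ℕ) := fun x _ y _ h =>
    Nat.eq_of_mul_eq_mul_left (by omega) h
  rw [sigma_one_apply, sigma_one_apply, Finset.mul_sum, ← Finset.sum_image (f := fun d => d) hinj]
  refine Finset.sum_lt_sum_of_subset (i := 1) ?_ ?_ ?_ one_pos fun _ _ _ => Nat.zero_le _
  · intro x hx
    obtain ⟨d, hd, rfl⟩ := Finset.mem_image.1 hx
    refine Nat.mem_divisors.2 ⟨?_, mul_ne_zero hk (by omega)⟩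
    rw [mul_comm k]
    exact mul_dvd_mul_left c (Nat.dvd_of_mem_divisors hd)
  · exact Nat.one_mem_divisors.2 (mul_ne_zero hk (by omega))
  · intro h
    obtain ⟨d, -, hd⟩ := Finset.mem_image.1 h
    have := Nat.eq_one_of_mul_eq_one_right hd
    omega

open ArithmeticFunction in
theorem mul_sigma_one_le_sigma_one_mul {k : ℕ} (c : ℕ) (hk : k ≠ 0) :
    c * sigma 1 k ≤ sigma 1 (k * c) := by
  rcases Nat.lt_or_ge 1 c with hc | hc
  · exact (mul_sigma_one_lt_sigma_one_mul hk hc).le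
  · interval_cases c <;> simp

open ArithmeticFunction in
/-- If an odd number is not a square, its divisors pair off with even sums. -/
theorem Odd.isSquare_of_odd_sigma_one {n : ℕ} (hn : Odd n) (hs : Odd (sigma 1 n)) :
    IsSquare n := by
  by_contra hsq
  have hz : ((sigma 1 n : ℕ) : ZMod 2) = 0 := by
    rw [sigma_one_apply, Nat.cast_sum]
    have hodd : ∀ d ∈ n.divisors, ((d : ℕ) : ZMod 2) = 1 := fun d hd =>
      ZMod.natCast_eq_one_iff_odd.2 (hn.of_dvd_nat (Nat.dvd_of_mem_divisors hd))
    have hmem : ∀ d ∈ n.divisors, n / d ∈ n.divisors := fun d hd =>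
      Nat.mem_divisors.2 ⟨Nat.div_dvd_of_dvd (Nat.dvd_of_mem_divisors hd), hn.pos.ne'⟩
    refine Finset.sum_involution (fun d _ => n / d) ?_ ?_ hmem ?_
    · intro d hd
      rw [hodd d hd, hodd _ (hmem d hd)]
      decide
    · intro d hd _ h
      exact hsq ⟨d, by
        have := Nat.mul_div_cancel' (Nat.dvd_of_mem_divisors hd)
        rw [h] at this
        exact this.symm⟩
    · intro d hd
      exact Nat.div_div_self (Nat.dvd_of_mem_divisors hd) hn.pos.ne'
  rw [ZMod.natCast_eq_zero_iff_even] at hz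
  exact Nat.not_even_iff_odd.2 hs hz

/-- A friend of 20 has the form `2·5^(2a)·m²` with `m` odd, coprime to 5, 3 and 7. -/
theorem friend20_form (N : ℕ) (hN : IsFriendOf20 N) :
    ∃ a m : ℕ, 0 < a ∧ 0 < m ∧ Odd m ∧ Nat.Coprime m 5 ∧
      Nat.Coprime m 3 ∧ Nat.Coprime m 7 ∧ N = 2 * 5 ^ (2 * a) * m ^ 2 := by
  obtain ⟨hlt, hσ⟩ := hN
  have h20 : ¬ 20 ∣ N := by
    rintro ⟨c, rfl⟩
    have h := mul_sigma_one_lt_sigma_one_mul (k := 20) (c := c) (by norm_num) (by omega)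
    rw [show ArithmeticFunction.sigma 1 20 = 42 by decide +kernel] at h
    omega
  obtain ⟨M, rfl⟩ : 2 ∣ N := by omega
  have hM : Odd M := by
    rw [Nat.odd_iff]
    omega
  have hσM : 5 * ArithmeticFunction.sigma 1 M = 7 * M := by
    rw [ArithmeticFunction.isMultiplicative_sigma.map_mul_of_coprime
      (Nat.coprime_two_left.2 hM),
      show ArithmeticFunction.sigma 1 2 = 3 by decide +kernel] at hσ
    omega
  obtain ⟨r, rfl⟩ : IsSquare M := hM.isSquare_of_odd_sigma_one (by
    rw [Nat.odd_iff] at hM ⊢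
    omega)
  have hr : r ≠ 0 := by
    rintro rfl
    simp at hM
  have h5 : 5 ∣ r := by
    have : 5 ∣ r * r := by omega
    exact (Nat.Prime.dvd_mul (by norm_num)).1 this |>.elim id id
  have not_dvd : ∀ k s, k ≠ 0 → ArithmeticFunction.sigma 1 (k * k) = s →
      7 * (k * k) < 5 * s → ¬ k ∣ r := by
    rintro k s hk hs hks ⟨c, rfl⟩
    have h := mul_sigma_one_le_sigma_one_mul (k := k * k) (c * c) (mul_ne_zero hk hk)
    rw [hs, ← mul_mul_mul_comm] at h
    have hc : 0 < c * c :=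
      Nat.pos_of_ne_zero (mul_self_ne_zero.2 (right_ne_zero_of_mul hr))
    nlinarith
  have h3 : ¬ 3 ∣ r := fun h => not_dvd 15 403 (by norm_num) (by decide +kernel) (by norm_num)
    (by omega)
  have h7 : ¬ 7 ∣ r := fun h => not_dvd 35 1767 (by norm_num) (by decide +kernel) (by norm_num)
    (by omega)
  obtain ⟨a, m, hm5, rfl⟩ := Nat.exists_eq_pow_mul_and_not_dvd hr 5 (by norm_num)
  have coprime_of : ∀ p, p.Prime → ¬ p ∣ m → m.Coprime p := fun p hp h =>
    ((Nat.Prime.coprime_iff_not_dvd hp).2 h).symm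
  refine ⟨a, m, ?_, Nat.pos_of_ne_zero (right_ne_zero_of_mul hr), ?_,
    coprime_of 5 (by norm_num) hm5,
    coprime_of 3 (by norm_num) fun h => h3 (h.mul_left _),
    coprime_of 7 (by norm_num) fun h => h7 (h.mul_left _), by ring⟩
  · rw [Nat.pos_iff_ne_zero]
    rintro rfl
    simp at h5
    exact hm5 h5
  · exact (Nat.odd_mul.1 (Nat.odd_mul.1 hM).1).2
end

section
/- If N is a friend of 20, then N has at least six distinct prime divisors, i.e. ω(N) ≥ 6, where ω(N) denotes the number of distinct prime divisors of N. -/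
open ArithmeticFunction

/-- Multiplying by `k > 1` strictly increases the abundancy index. -/
lemma mul_sigma_lt_sigma_mul {d k : ℕ} (hd : d ≠ 0) (hk : 1 < k) :
    k * sigma 1 d < sigma 1 (d * k) := by
  have hne : d * k ≠ 0 := by positivity
  have hsum : k * sigma 1 d = ∑ e ∈ d.divisors.image (k * ·), e := by
    rw [Finset.sum_image (fun a _ b _ h => Nat.eq_of_mul_eq_mul_left (by omega) h),
      ← Finset.mul_sum, sigma_one_apply]
  rw [hsum, sigma_one_apply]
  refine Finset.sum_lt_sum_of_subset (i := 1) ?_ (by simpa using ⟨by omega, by omega⟩) ?_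
    one_pos (fun _ _ _ => Nat.zero_le _)
  · intro e he
    obtain ⟨x, hx, rfl⟩ := Finset.mem_image.mp he
    rw [Nat.mem_divisors] at hx ⊢
    exact ⟨mul_comm d k ▸ mul_dvd_mul_left k hx.1, hne⟩
  · intro h
    obtain ⟨x, -, hx⟩ := Finset.mem_image.mp h
    have := Nat.eq_one_of_mul_eq_one_right hx
    omega

/-- The abundancy index is monotone for divisibility. -/
lemma sigma_mul_le_of_dvd {d m : ℕ} (hm : m ≠ 0) (h : d ∣ m) :
    sigma 1 d * m ≤ sigma 1 m * d := by
  obtain ⟨k, rfl⟩ := h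
  have hd : d ≠ 0 := left_ne_zero_of_mul hm
  have hk : k ≠ 0 := right_ne_zero_of_mul hm
  obtain rfl | hk1 : k = 1 ∨ 1 < k := by omega
  · simp
  · nlinarith [mul_sigma_lt_sigma_mul hd hk1, Nat.pos_of_ne_zero hd]

lemma geom_sum_mul_pred_lt {p : ℕ} (hp : 0 < p) (k : ℕ) :
    (∑ i ∈ Finset.range (k + 1), p ^ i) * (p - 1) < p ^ k * p := by
  obtain ⟨x, rfl⟩ : ∃ x, p = x + 1 := ⟨p - 1, by omega⟩
  rw [← pow_succ, ← geom_sum_mul_add]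
  simp

lemma sigma_mul_prod_pred_le {n : ℕ} (hn : n ≠ 0) {T : Finset ℕ} (hT : n.primeFactors ⊆ T) :
    sigma 1 n * ∏ p ∈ T, (p - 1) ≤ n * ∏ p ∈ T, p := by
  have hσ : sigma 1 n = ∏ p ∈ T, sigma 1 (p ^ n.factorization p) := by
    rw [isMultiplicative_sigma.multiplicative_factorization _ hn]
    exact Finsupp.prod_of_support_subset _ hT _ (by simp)
  have hprod : n = ∏ p ∈ T, p ^ n.factorization p := by
    conv_lhs => rw [← Nat.prod_factorization_pow_eq_self hn]
    exact Finsupp.prod_of_support_subset _ hT _ (by simp)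
  rw [hσ, ← Finset.prod_mul_distrib]
  conv_rhs => rw [hprod, ← Finset.prod_mul_distrib]
  refine Finset.prod_le_prod' fun p _ => ?_
  by_cases hp : p.Prime
  · rw [sigma_one_apply_prime_pow hp]
    exact (geom_sum_mul_pred_lt hp.pos _).le
  · simp [Nat.factorization_eq_zero_of_not_prime n hp]

lemma sigma_prime_pow_dvd {p m : ℕ} (hp : p.Prime) (hm : m ≠ 0) :
    sigma 1 (p ^ m.factorization p) ∣ sigma 1 m := by
  conv_rhs => rw [← Nat.ordProj_mul_ordCompl_eq_self m p]
  rw [isMultiplicative_sigma.map_mul_of_coprime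
    ((Nat.coprime_ordCompl hp hm).pow_left _)]
  exact dvd_mul_right _ _

lemma even_of_odd_sigma_prime_pow {p k : ℕ} (hp : p.Prime) (hp2 : Odd p)
    (h : Odd (sigma 1 (p ^ k))) : Even k := by
  rw [sigma_one_apply_prime_pow hp, Finset.odd_sum_iff_odd_card_odd] at h
  simpa [hp2.pow, Nat.odd_add_one] using h

lemma sigma_mul_prime_pow {p k n : ℕ} (hp : p.Prime) (hpn : ¬ p ∣ n) :
    sigma 1 (p ^ k * n) = (∑ i ∈ Finset.range (k + 1), p ^ i) * sigma 1 n := by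
  rw [isMultiplicative_sigma.map_mul_of_coprime
    (((Nat.Prime.coprime_iff_not_dvd hp).mpr hpn).pow_left _), sigma_one_apply_prime_pow hp]

/-- `m` is odd, prime to `3`, has abundancy index `7/5`, and its prime divisors other than `5`
lie in `{q, r, s}`; conversely each of `q`, `r`, `s` below `100000` is such a divisor. Larger
values may be mere placeholders, so that `m` may also have fewer than four prime divisors. -/
structure IsCandidate (m q r s : ℕ) : Prop where
  sigma_eq : 5 * sigma 1 m = 7 * m
  ne_zero : m ≠ 0
  not_two_dvd : ¬ 2 ∣ m
  not_three_dvd : ¬ 3 ∣ m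
  lt_qr : q < r
  lt_rs : r < s
  mem : ∀ p, p = q ∨ p = r ∨ p = s → p < 100000 → p.Prime ∧ p ∣ m ∧ p ≠ 5
  cover : ∀ p, p.Prime → p ∣ m → p = 5 ∨ p = q ∨ p = r ∨ p = s

namespace IsCandidate

variable {m q r s : ℕ}

lemma five_dvd (h : IsCandidate m q r s) : 5 ∣ m :=
  (Nat.Coprime.dvd_mul_left (by norm_num : Nat.Coprime 5 7)).mp (h.sigma_eq ▸ dvd_mul_right 5 _)

lemma even_factorization (h : IsCandidate m q r s) {p : ℕ} (hp : p.Prime) (hpm : p ∣ m) :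
    Even (m.factorization p) := by
  have hp2 : Odd p := hp.odd_of_ne_two (by rintro rfl; exact h.not_two_dvd hpm)
  refine even_of_odd_sigma_prime_pow hp hp2 ?_
  have hodd : Odd (sigma 1 m) := by
    have := h.sigma_eq
    have := h.not_two_dvd
    rw [Nat.odd_iff]; omega
  exact hodd.of_dvd_nat (sigma_prime_pow_dvd hp h.ne_zero)

lemma two_le_factorization (h : IsCandidate m q r s) {p : ℕ} (hp : p.Prime) (hpm : p ∣ m) :
    2 ≤ m.factorization p := by
  obtain ⟨k, hk⟩ := h.even_factorization hp hpm
  have := hp.factorization_pos_of_dvd h.ne_zero hpm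
  omega

lemma one_le_factorization (h : IsCandidate m q r s) {p : ℕ} (hp : p.Prime) (hpm : p ∣ m) :
    1 ≤ m.factorization p :=
  one_le_two.trans (h.two_le_factorization hp hpm)

/-- A prime `t ≠ 7` dividing `σ(p ^ v)`, with `p ^ v` exactly dividing `m`, divides `m`. -/
lemma dvd_of_dvd_sigma (h : IsCandidate m q r s) {p t v : ℕ} (hp : p.Prime) (ht : t.Prime)
    (ht7 : t ≠ 7) (hv : m.factorization p = v) (htσ : t ∣ sigma 1 (p ^ v)) : t ∣ m := by
  subst hv
  have h1 : t ∣ 7 * m := h.sigma_eq ▸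
    (htσ.trans (sigma_prime_pow_dvd hp h.ne_zero)).mul_left 5
  refine (ht.dvd_mul.mp h1).resolve_left fun h7 => ht7 ?_
  exact (Nat.prime_dvd_prime_iff_eq ht (by norm_num)).mp h7

/-- If a prime `t ≠ 7` divides `σ(p ^ v)` but not `m`, then the bound `v` on the exponent of `p`,
with `v` even, can be improved to `v + 2`. -/
lemma add_two_le_factorization (h : IsCandidate m q r s) {p v : ℕ} (t : ℕ) (hp : p.Prime)
    (hv : Even v) (hv0 : v ≠ 0) (hpm : v ≤ m.factorization p) (ht : t.Prime) (ht7 : t ≠ 7)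
    (htσ : t ∣ ∑ i ∈ Finset.range (v + 1), p ^ i) (htm : ¬ t ∣ m) :
    v + 2 ≤ m.factorization p := by
  obtain ⟨k, hk⟩ := h.even_factorization hp (Nat.dvd_of_factorization_pos (by omega))
  obtain ⟨l, hl⟩ := hv
  have hne : m.factorization p ≠ v := fun he => htm <|
    h.dvd_of_dvd_sigma hp ht ht7 he (by rwa [sigma_one_apply_prime_pow hp])
  omega

/-- No divisor of `m` has abundancy index above `7/5`. -/
lemma sigma_le (h : IsCandidate m q r s) {d : ℕ} (hd : d ∣ m) : 5 * sigma 1 d ≤ 7 * d := by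
  have h1 := sigma_mul_le_of_dvd h.ne_zero hd
  have h2 := h.sigma_eq
  refine le_of_mul_le_mul_right ?_ (Nat.pos_of_ne_zero h.ne_zero)
  nlinarith

/-- The abundancy bound for divisors, in terms of prime powers `l = [(p₁, k₁), …]`. -/
lemma prod_geom_sum_le (h : IsCandidate m q r s) (l : List (ℕ × ℕ))
    (hl : ∀ x ∈ l, x.1.Prime ∧ x.2 ≤ m.factorization x.1) (hnd : (l.map Prod.fst).Nodup) :
    5 * (l.map fun x => ∑ i ∈ Finset.range (x.2 + 1), x.1 ^ i).prod
      ≤ 7 * (l.map fun x => x.1 ^ x.2).prod := by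
  suffices H : (l.map fun x => x.1 ^ x.2).prod ∣ m ∧
      sigma 1 (l.map fun x => x.1 ^ x.2).prod
        = (l.map fun x => ∑ i ∈ Finset.range (x.2 + 1), x.1 ^ i).prod by
    rw [← H.2]; exact h.sigma_le H.1
  induction l with
  | nil => simp
  | cons x l ih =>
    simp only [List.map_cons, List.nodup_cons, List.prod_cons] at hnd ⊢
    obtain ⟨ih1, ih2⟩ := ih (fun y hy => hl y (List.mem_cons_of_mem _ hy)) hnd.2
    obtain ⟨hx, hxm⟩ := hl x List.mem_cons_self
    rw [← hx.pow_dvd_iff_le_factorization h.ne_zero] at hxm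
    have hndvd : ¬ x.1 ∣ (l.map fun x => x.1 ^ x.2).prod := by
      intro hdvd
      obtain ⟨a, ha, hxa⟩ := (Prime.dvd_prod_iff hx.prime).mp hdvd
      obtain ⟨y, hy, rfl⟩ := List.mem_map.mp ha
      have hxy := (Nat.prime_dvd_prime_iff_eq hx (hl y (List.mem_cons_of_mem _ hy)).1).mp
        (hx.dvd_of_dvd_pow hxa)
      exact hnd.1 (List.mem_map.mpr ⟨y, hy, hxy.symm⟩)
    refine ⟨Nat.Coprime.mul_dvd_of_dvd_of_dvd
      (((Nat.Prime.coprime_iff_not_dvd hx).mpr hndvd).pow_left _) hxm ih1, ?_⟩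
    rw [sigma_mul_prime_pow hx hndvd, ih2]

/-- The upper bound on the abundancy index of `m`, keeping the contribution of `5` exact. -/
lemma upper_exact (h : IsCandidate m q r s) :
    7 * 5 ^ m.factorization 5 * ((q - 1) * ((r - 1) * (s - 1)))
      ≤ 5 * sigma 1 (5 ^ m.factorization 5) * (q * (r * s)) := by
  have hqr := h.lt_qr
  have hrs := h.lt_rs
  set n := m / 5 ^ m.factorization 5 with hn
  have hmn : 5 ^ m.factorization 5 * n = m := Nat.ordProj_mul_ordCompl_eq_self m 5
  have hcop : Nat.Coprime 5 n := Nat.coprime_ordCompl (by norm_num) h.ne_zero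
  have hn0 : n ≠ 0 := by rintro h0; rw [h0, mul_zero] at hmn; exact h.ne_zero hmn.symm
  have hT : n.primeFactors ⊆ {q, r, s} := by
    intro p hp
    obtain ⟨hp, hpn, -⟩ := Nat.mem_primeFactors.mp hp
    have := (h.cover p hp (hmn ▸ hpn.mul_left _)).resolve_left
      (by rintro rfl; exact (Nat.Prime.coprime_iff_not_dvd hp).mp hcop hpn)
    simpa using this
  have hle := sigma_mul_prod_pred_le hn0 hT
  have hq : q ∉ ({r, s} : Finset ℕ) := by simp; omega
  have hr : r ∉ ({s} : Finset ℕ) := by simp; omega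
  simp only [Finset.prod_insert hq, Finset.prod_insert hr, Finset.prod_singleton] at hle
  have hσ : sigma 1 m = sigma 1 (5 ^ m.factorization 5) * sigma 1 n := by
    conv_lhs => rw [← hmn]
    exact isMultiplicative_sigma.map_mul_of_coprime (hcop.pow_left _)
  have heq := h.sigma_eq
  rw [hσ] at heq
  refine le_of_mul_le_mul_right ?_ (Nat.pos_of_ne_zero hn0)
  calc 7 * 5 ^ m.factorization 5 * ((q - 1) * ((r - 1) * (s - 1))) * n
      = 7 * (5 ^ m.factorization 5 * n) * ((q - 1) * ((r - 1) * (s - 1))) := by ring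
    _ = 5 * sigma 1 (5 ^ m.factorization 5) *
          (sigma 1 n * ((q - 1) * ((r - 1) * (s - 1)))) := by rw [hmn, ← heq]; ring
    _ ≤ 5 * sigma 1 (5 ^ m.factorization 5) * (n * (q * (r * s))) := by gcongr
    _ = _ := by ring

lemma two_le (h : IsCandidate m q r s) : 2 ≤ q := by
  by_contra hq
  exact hq (h.mem q (.inl rfl) (by omega)).1.two_le

lemma upper (h : IsCandidate m q r s) :
    28 * ((q - 1) * ((r - 1) * (s - 1))) < 25 * (q * (r * s)) := by
  have h1 := h.upper_exact
  have h2 := geom_sum_mul_pred_lt (p := 5) (by norm_num) (m.factorization 5)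
  rw [← sigma_one_apply_prime_pow (by norm_num)] at h2
  have hqr := h.lt_qr
  have hrs := h.lt_rs
  have hq := h.two_le
  have hpos : 0 < q * (r * s) := Nat.mul_pos (by omega) (Nat.mul_pos (by omega) (by omega))
  generalize m.factorization 5 = a at *
  have h5 : 0 < 5 ^ a := by positivity
  refine lt_of_mul_lt_mul_right ?_ h5.le
  norm_num at h2
  nlinarith [Nat.mul_lt_mul_of_pos_right h2 hpos]

end IsCandidate

lemma mul_pred_lt_of_le {x y p P : ℕ} (hP : 0 < P) (hPp : P ≤ p) (h : x * (p - 1) < y * p) :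
    x * (P - 1) < y * P := by
  obtain ⟨a, rfl⟩ : ∃ a, P = a + 1 := ⟨P - 1, by omega⟩
  obtain ⟨b, rfl⟩ : ∃ b, p = b + 1 := ⟨p - 1, by omega⟩
  simp only [Nat.add_sub_cancel] at *
  rcases le_or_gt x y with hxy | hxy
  · have : 0 < y := by
      by_contra h0
      have : y = 0 := by omega
      subst this; simp at h
    nlinarith
  · nlinarith

/-- Upper bounds for abundancy indices decrease in the primes. -/
lemma upper_antitone {A B q r s Q R S : ℕ} (hQ : 0 < Q) (hR : 0 < R) (hS : 0 < S)
    (hq : Q ≤ q) (hr : R ≤ r) (hs : S ≤ s)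
    (h : A * ((q - 1) * ((r - 1) * (s - 1))) < B * (q * (r * s))) :
    A * ((Q - 1) * ((R - 1) * (S - 1))) < B * (Q * (R * S)) := by
  have h1 : (A * ((r - 1) * (s - 1))) * (Q - 1) < (B * (r * s)) * Q :=
    mul_pred_lt_of_le hQ hq (by linarith)
  have h2 : (A * ((Q - 1) * (s - 1))) * (R - 1) < (B * (Q * s)) * R :=
    mul_pred_lt_of_le hR hr (by linarith)
  have h3 : (A * ((Q - 1) * (R - 1))) * (S - 1) < (B * (Q * R)) * S :=
    mul_pred_lt_of_le hS hs (by linarith)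
  linarith

/-- `1 + p + ⋯ + p ^ k`, the sum of divisors of `p ^ k` for `p` prime. -/
def powSum (p k : ℕ) : ℕ := ∑ i ∈ Finset.range (k + 1), p ^ i

namespace IsCandidate

variable {m q r s : ℕ}

lemma powSum_mul_le_three (h : IsCandidate m q r s) {a b c x y : ℕ} (hx : x.Prime) (hy : y.Prime)
    (hx5 : x ≠ 5) (hy5 : y ≠ 5) (hxy : x ≠ y) (h5m : a ≤ m.factorization 5)
    (hxm : b ≤ m.factorization x)
    (hym : c ≤ m.factorization y) :
    5 * (powSum 5 a * (powSum x b * powSum y c)) ≤ 7 * (5 ^ a * (x ^ b * y ^ c)) := by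
  have := h.prod_geom_sum_le [(5, a), (x, b), (y, c)]
    (by simp [*, Nat.prime_five]) (by simp [*, hx5.symm, hy5.symm])
  simpa [powSum] using this

lemma powSum_mul_le_four (h : IsCandidate m q r s) {a b c d x y z : ℕ} (hx : x.Prime)
    (hy : y.Prime) (hz : z.Prime) (hx5 : x ≠ 5) (hy5 : y ≠ 5) (hz5 : z ≠ 5) (hxy : x ≠ y)
    (hxz : x ≠ z) (hyz : y ≠ z) (h5m : a ≤ m.factorization 5) (hxm : b ≤ m.factorization x)
    (hym : c ≤ m.factorization y)
    (hzm : d ≤ m.factorization z) :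
    5 * (powSum 5 a * (powSum x b * (powSum y c * powSum z d)))
      ≤ 7 * (5 ^ a * (x ^ b * (y ^ c * z ^ d))) := by
  have := h.prod_geom_sum_le [(5, a), (x, b), (y, c), (z, d)]
    (by simp [*, Nat.prime_five]) (by simp [*, hx5.symm, hy5.symm, hz5.symm])
  simpa [powSum] using this

end IsCandidate

lemma not_prime_of_mem_Icc {s : ℕ} (a b : ℕ) (has : a ≤ s) (hsb : s ≤ b)
    (h : ∀ n ∈ Finset.Icc a b, ¬ n.Prime) : ¬ s.Prime :=
  h s (Finset.mem_Icc.mpr ⟨has, hsb⟩)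

lemma no_primes_with_eleven {r s : ℕ} (hr : r.Prime) (hs : s.Prime) (hr1 : 59 ≤ r) (hr2 : r < 113)
    (hrs : r < s) (hup : 28 * ((11 - 1) * ((r - 1) * (s - 1))) < 25 * (11 * (r * s)))
    (hlow : ∀ k ≤ 2, 5 * (powSum 5 8 * (powSum 11 6 * (powSum r 2 * powSum s k)))
      ≤ 7 * (5 ^ 8 * (11 ^ 6 * (r ^ 2 * s ^ k)))) : False := by
  have hlow1 := hlow 1 (by norm_num)
  have hlow2 := hlow 2 le_rfl
  clear hlow
  simp only [powSum, Finset.sum_range_succ, Finset.sum_range_zero, pow_zero, pow_one] at hlow1 hlow2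
  have hcases : r ∈ (Finset.Ico 59 113).filter Nat.Prime := by
    simp only [Finset.mem_filter, Finset.mem_Ico]; exact ⟨⟨hr1, hr2⟩, hr⟩
  rw [show (Finset.Ico 59 113).filter Nat.Prime
    = {59, 61, 67, 71, 73, 79, 83, 89, 97, 101, 103, 107, 109} by decide +kernel] at hcases
  simp only [Finset.mem_insert, Finset.mem_singleton] at hcases
  revert hs
  rcases hcases with rfl | rfl | rfl | rfl | rfl | rfl | rfl | rfl | rfl | rfl | rfl | rfl | rfl
  · exact not_prime_of_mem_Icc 1076 1082 (by omega) (by omega) (by decide +kernel)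
  · exact not_prime_of_mem_Icc 669 671 (by omega) (by omega) (by decide +kernel)
  · exact not_prime_of_mem_Icc 335 335 (by omega) (by omega) (by decide +kernel)
  · exact not_prime_of_mem_Icc 261 261 (by omega) (by omega) (by decide +kernel)
  · exact not_prime_of_mem_Icc 237 237 (by omega) (by omega) (by decide +kernel)
  · exact not_prime_of_mem_Icc 189 189 (by omega) (by omega) (by decide +kernel)
  · exact not_prime_of_mem_Icc 170 170 (by omega) (by omega) (by decide +kernel)
  · obtain rfl : s = 149 := by omega
    norm_num at hlow2
  · obtain rfl : s = 131 := by omega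
    norm_num at hlow2
  · exact not_prime_of_mem_Icc 124 124 (by omega) (by omega) (by decide +kernel)
  · exact not_prime_of_mem_Icc 121 121 (by omega) (by omega) (by decide +kernel)
  · exact not_prime_of_mem_Icc 116 116 (by omega) (by omega) (by decide +kernel)
  · exact not_prime_of_mem_Icc 114 114 (by omega) (by omega) (by decide +kernel)

lemma no_primes_with_thirteen {r s : ℕ} (hr : r.Prime) (hs : s.Prime) (hr1 : 37 ≤ r) (hr2 : r < 61)
    (hr43 : r ≠ 43) (hrs : r < s)
    (hup : 28 * ((13 - 1) * ((r - 1) * (s - 1))) < 25 * (13 * (r * s)))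
    (hlow : ∀ k ≤ 2, 5 * (powSum 5 8 * (powSum 13 6 * (powSum r 2 * powSum s k)))
      ≤ 7 * (5 ^ 8 * (13 ^ 6 * (r ^ 2 * s ^ k)))) : False := by
  have hlow1 := hlow 1 (by norm_num)
  have hlow2 := hlow 2 le_rfl
  clear hlow
  simp only [powSum, Finset.sum_range_succ, Finset.sum_range_zero, pow_zero, pow_one] at hlow1 hlow2
  have hcases : r ∈ (Finset.Ico 37 61).filter Nat.Prime := by
    simp only [Finset.mem_filter, Finset.mem_Ico]; exact ⟨⟨hr1, hr2⟩, hr⟩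
  rw [show (Finset.Ico 37 61).filter Nat.Prime
    = {37, 41, 43, 47, 53, 59} by decide +kernel] at hcases
  simp only [Finset.mem_insert, Finset.mem_singleton] at hcases
  revert hs
  rcases hcases with rfl | rfl | rfl | rfl | rfl | rfl
  · exact not_prime_of_mem_Icc 169 170 (by omega) (by omega) (by decide +kernel)
  · exact not_prime_of_mem_Icc 116 116 (by omega) (by omega) (by decide +kernel)
  · exact absurd rfl hr43
  · exact not_prime_of_mem_Icc 85 85 (by omega) (by omega) (by decide +kernel)
  · exact not_prime_of_mem_Icc 70 70 (by omega) (by omega) (by decide +kernel)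
  · exact not_prime_of_mem_Icc 62 62 (by omega) (by omega) (by decide +kernel)

lemma no_primes_with_seventeen {r s : ℕ} (hr : r.Prime) (hs : s.Prime) (hr1 : 23 ≤ r) (hr2 : r < 41)
    (hrs : r < s) (hup : 28 * ((17 - 1) * ((r - 1) * (s - 1))) < 25 * (17 * (r * s)))
    (hlow : ∀ k ≤ 2, 5 * (powSum 5 6 * (powSum 17 2 * (powSum r 2 * powSum s k)))
      ≤ 7 * (5 ^ 6 * (17 ^ 2 * (r ^ 2 * s ^ k)))) : False := by
  have hlow1 := hlow 1 (by norm_num)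
  have hlow2 := hlow 2 le_rfl
  clear hlow
  simp only [powSum, Finset.sum_range_succ, Finset.sum_range_zero, pow_zero, pow_one] at hlow1 hlow2
  have hcases : r ∈ (Finset.Ico 23 41).filter Nat.Prime := by
    simp only [Finset.mem_filter, Finset.mem_Ico]; exact ⟨⟨hr1, hr2⟩, hr⟩
  rw [show (Finset.Ico 23 41).filter Nat.Prime
    = {23, 29, 31, 37} by decide +kernel] at hcases
  simp only [Finset.mem_insert, Finset.mem_singleton] at hcases
  revert hs
  rcases hcases with rfl | rfl | rfl | rfl
  · exact not_prime_of_mem_Icc 117 121 (by omega) (by omega) (by decide +kernel)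
  · exact not_prime_of_mem_Icc 56 57 (by omega) (by omega) (by decide +kernel)
  · exact not_prime_of_mem_Icc 50 50 (by omega) (by omega) (by decide +kernel)
  · exact not_prime_of_mem_Icc 39 40 (by omega) (by omega) (by decide +kernel)

lemma no_primes_with_nineteen {r s : ℕ} (hr : r.Prime) (hs : s.Prime) (hr1 : 23 ≤ r) (hr2 : r < 37)
    (hrs : r < s) (hup : 28 * ((19 - 1) * ((r - 1) * (s - 1))) < 25 * (19 * (r * s)))
    (hlow : ∀ k ≤ 2, 5 * (powSum 5 6 * (powSum 19 4 * (powSum r 2 * powSum s k)))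
      ≤ 7 * (5 ^ 6 * (19 ^ 4 * (r ^ 2 * s ^ k)))) : False := by
  have hlow1 := hlow 1 (by norm_num)
  have hlow2 := hlow 2 le_rfl
  clear hlow
  simp only [powSum, Finset.sum_range_succ, Finset.sum_range_zero, pow_zero, pow_one] at hlow1 hlow2
  have hcases : r ∈ (Finset.Ico 23 37).filter Nat.Prime := by
    simp only [Finset.mem_filter, Finset.mem_Ico]; exact ⟨⟨hr1, hr2⟩, hr⟩
  rw [show (Finset.Ico 23 37).filter Nat.Prime
    = {23, 29, 31} by decide +kernel] at hcases
  simp only [Finset.mem_insert, Finset.mem_singleton] at hcases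
  revert hs
  rcases hcases with rfl | rfl | rfl
  · obtain rfl | hs : s = 67 ∨ s = 68 := by omega
    · norm_num at hlow2
    · rw [hs]; norm_num
  · obtain rfl : s = 41 := by omega
    norm_num at hlow2
  · exact not_prime_of_mem_Icc 38 38 (by omega) (by omega) (by decide +kernel)

namespace IsCandidate

variable {m q r s : ℕ}

lemma eleven_le (h : IsCandidate m q r s) : 11 ≤ q := by
  by_contra hlt
  obtain ⟨hq, hqm, hq5⟩ := h.mem q (.inl rfl) (by omega)
  have hq7 : q ≠ 7 := by
    rintro rfl
    have := h.prod_geom_sum_le [(5, 2), (7, 2)]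
      (by simpa using ⟨⟨Nat.prime_five, h.two_le_factorization Nat.prime_five h.five_dvd⟩,
        hq, h.two_le_factorization hq hqm⟩) (by simp)
    simp [Finset.sum_range_succ] at this
  have hq2 : q ≠ 2 := fun e => h.not_two_dvd (e ▸ hqm)
  have hq3 : q ≠ 3 := fun e => h.not_three_dvd (e ▸ hqm)
  have hlt' : q < 11 := by omega
  interval_cases q <;> first | omega | (revert hq; norm_num)

/-- The possible values of the smallest prime divisor other than `5`. -/
lemma smallest_mem (h : IsCandidate m q r s) : q = 11 ∨ q = 13 ∨ q = 17 ∨ q = 19 := by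
  have h11 := h.eleven_le
  have hqr := h.lt_qr
  have hrs := h.lt_rs
  have hprime : ∀ a b, (∀ n ∈ Finset.Icc a b, ¬ n.Prime) → b < 100000 →
      ∀ p, p = q ∨ p = r ∨ p = s → a ≤ p → b < p := by
    intro a b hab hb p hp hap
    by_contra hlt
    exact not_prime_of_mem_Icc a b hap (by omega) hab (h.mem p hp (by omega)).1
  have hq19 : q ≤ 19 := by
    by_contra hlt
    have hq := hprime 20 22 (by decide +kernel) (by norm_num) q (by simp) (by omega)
    have hr := hprime 24 28 (by decide +kernel) (by norm_num) r (by simp) (by omega)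
    have hs := hprime 30 30 (by decide +kernel) (by norm_num) s (by simp) (by omega)
    have := upper_antitone (Q := 23) (R := 29) (S := 31) (by norm_num) (by norm_num)
      (by norm_num) hq hr hs h.upper
    norm_num at this
  have hq := (h.mem q (by simp) (by omega)).1
  interval_cases q <;> first | omega | (revert hq; norm_num)

/-- Splitting off a known prime divisor `y > 19`: the remaining one is called `x`. -/
lemma exists_third (h : IsCandidate m q r s) {y : ℕ} (hy : y.Prime) (hy19 : 19 < y) (hym : y ∣ m) :
    ∃ x, q < x ∧ x ≠ y ∧ (x < 100000 → x.Prime ∧ x ∣ m ∧ x ≠ 5) ∧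
      ∀ A B, A * ((q - 1) * ((r - 1) * (s - 1))) ≤ B * (q * (r * s)) →
        A * ((q - 1) * ((y - 1) * (x - 1))) ≤ B * (q * (y * x)) := by
  have hqr := h.lt_qr
  have hrs := h.lt_rs
  have hq := h.smallest_mem
  obtain hy | hy | rfl | rfl := h.cover y hy hym
  · omega
  · omega
  · exact ⟨s, by omega, by omega, h.mem s (by simp), fun A B hAB => hAB⟩
  · refine ⟨r, by omega, by omega, h.mem r (by simp), fun A B hAB => ?_⟩
    rwa [mul_comm (y - 1), mul_comm y]

lemma dvd_of_factorization_five (h : IsCandidate m q r s) {a t : ℕ}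
    (ha : m.factorization 5 = a) (ht : t.Prime) (ht7 : t ≠ 7) (htσ : t ∣ powSum 5 a) : t ∣ m :=
  h.dvd_of_dvd_sigma Nat.prime_five ht ht7 ha
    (by rwa [sigma_one_apply_prime_pow Nat.prime_five])

lemma factorization_five_ne_two (h : IsCandidate m q r s) : m.factorization 5 ≠ 2 := by
  intro ha
  have h31 : 31 ∣ m := h.dvd_of_factorization_five ha (by norm_num) (by norm_num)
      (by decide +kernel)
  have p31 : Nat.Prime 31 := by norm_num
  have h31' := h.two_le_factorization p31 h31
  have h5 := h.two_le_factorization Nat.prime_five h.five_dvd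
  obtain ⟨x, hqx, hx31, hx, hup⟩ := h.exists_third p31 (by norm_num) h31
  have hup := hup _ _ h.upper_exact
  rw [ha, sigma_one_apply_prime_pow Nat.prime_five] at hup
  have hq := h.mem q (by simp)
  have hq' := h.smallest_mem
  obtain ⟨hq, hqm, -⟩ := hq (by omega)
  have hqm' := h.two_le_factorization hq hqm
  obtain rfl | rfl | rfl | rfl := hq'
  · have := h.powSum_mul_le_three hq p31 (by norm_num) (by norm_num) (by norm_num) h5 hqm' h31'
    norm_num [powSum, Finset.sum_range_succ] at this
  · have h13 : 4 ≤ m.factorization 13 := h.add_two_le_factorization 3 hq even_two two_ne_zero hqm'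
      Nat.prime_three (by norm_num)
      (by decide +kernel) h.not_three_dvd
    simp only [Finset.sum_range_succ, Finset.sum_range_zero] at hup
    obtain ⟨hxp, hxm, hx5⟩ := hx (by omega)
    have := h.powSum_mul_le_four hq p31 hxp (by norm_num) (by norm_num) hx5 (by norm_num)
      (by omega) (by omega) h5 h13 h31' (h.one_le_factorization hxp hxm)
    simp only [powSum, Finset.sum_range_succ, Finset.sum_range_zero, pow_zero, pow_one] at this
    exact not_prime_of_mem_Icc 116 117 (by omega) (by omega) (by decide +kernel) hxp
  · simp only [Finset.sum_range_succ, Finset.sum_range_zero] at hup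
    obtain ⟨hxp, hxm, hx5⟩ := hx (by omega)
    have := h.powSum_mul_le_four hq p31 hxp (by norm_num) (by norm_num) hx5 (by norm_num)
      (by omega) (by omega) h5 hqm' h31' (h.one_le_factorization hxp hxm)
    simp only [powSum, Finset.sum_range_succ, Finset.sum_range_zero, pow_zero, pow_one] at this
    exact not_prime_of_mem_Icc 32 36 (by omega) (by omega) (by decide +kernel) hxp
  · simp only [Finset.sum_range_succ, Finset.sum_range_zero] at hup
    obtain ⟨hxp, hxm, hx5⟩ := hx (by omega)
    have := h.powSum_mul_le_four hq p31 hxp (by norm_num) (by norm_num) hx5 (by norm_num)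
      (by omega) (by omega) h5 hqm' h31' (h.two_le_factorization hxp hxm)
    simp only [powSum, Finset.sum_range_succ, Finset.sum_range_zero, pow_zero, pow_one] at this
    have hx29 : x ≤ 29 := by omega
    clear hup
    interval_cases x <;> omega

lemma six_le_factorization_eleven (h : IsCandidate m 11 r s) (h5 : 4 ≤ m.factorization 5) : 6 ≤
    m.factorization 11 := by
  obtain ⟨p11, h11, -⟩ := h.mem 11 (by simp) (by norm_num)
  have p19 : Nat.Prime 19 := by norm_num
  have p3221 : Nat.Prime 3221 := by norm_num
  have h19 : ¬ 19 ∣ m := by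
    intro h19
    have := h.powSum_mul_le_three p11 p19 (by norm_num) (by norm_num) (by norm_num) h5
      (h.two_le_factorization p11 h11) (h.two_le_factorization p19 h19)
    norm_num [powSum, Finset.sum_range_succ] at this
  have h11' : 4 ≤ m.factorization 11 := h.add_two_le_factorization 19 p11 even_two two_ne_zero
      (h.two_le_factorization p11 h11) p19 (by norm_num)
    (by decide +kernel) h19
  refine h.add_two_le_factorization 3221 p11 (by decide) (by norm_num) h11' p3221 (by norm_num)
    (by decide +kernel) fun h3221 => ?_
  obtain ⟨x, hqx, hxne, hx, hup⟩ := h.exists_third p3221 (by norm_num) h3221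
  have hup := hup _ _ h.upper.le
  obtain ⟨hxp, hxm, hx5⟩ := hx (by omega)
  have := h.powSum_mul_le_four p11 p3221 hxp (by norm_num) (by norm_num) hx5 (by norm_num)
    (by omega) (by omega) h5 h11' (h.one_le_factorization p3221 h3221)
    (h.one_le_factorization hxp hxm)
  simp only [powSum, Finset.sum_range_succ, Finset.sum_range_zero, pow_zero, pow_one] at this
  exact not_prime_of_mem_Icc 54 56 (by omega) (by omega) (by decide +kernel) hxp

lemma factorization_five_ne_four (h : IsCandidate m q r s) : m.factorization 5 ≠ 4 := by
  intro ha
  have h71 : 71 ∣ m := h.dvd_of_factorization_five ha (by norm_num) (by norm_num)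
      (by decide +kernel)
  have h11 : 11 ∣ m := h.dvd_of_factorization_five ha (by norm_num) (by norm_num)
      (by decide +kernel)
  have p11 : Nat.Prime 11 := by norm_num
  have p71 : Nat.Prime 71 := by norm_num
  obtain rfl : q = 11 := by
    have := h.cover 11 p11 h11
    have := h.eleven_le
    have := h.lt_qr
    have := h.lt_rs
    omega
  have h5 : 4 ≤ m.factorization 5 := ha.ge
  have h11' := h.six_le_factorization_eleven h5
  obtain ⟨x, hqx, hxne, hx, hup⟩ := h.exists_third p71 (by norm_num) h71
  have hup := hup _ _ h.upper_exact
  rw [ha, sigma_one_apply_prime_pow Nat.prime_five] at hup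
  simp only [Finset.sum_range_succ, Finset.sum_range_zero] at hup
  obtain ⟨hxp, hxm, hx5⟩ := hx (by omega)
  have hlow {k : ℕ} (hk : k ≤ m.factorization x) := h.powSum_mul_le_four p11 p71 hxp (by norm_num)
    (by norm_num) hx5 (by norm_num) (by omega) (by omega) h5 h11' (h.two_le_factorization p71 h71)
    hk
  have hlow1 := hlow (h.one_le_factorization hxp hxm)
  have hlow2 := hlow (h.two_le_factorization hxp hxm)
  simp only [powSum, Finset.sum_range_succ, Finset.sum_range_zero, pow_zero, pow_one]
    at hlow1 hlow2
  obtain rfl : x = 241 := by omega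
  norm_num at hlow2

lemma six_le_factorization_five (h : IsCandidate m q r s) : 6 ≤ m.factorization 5 := by
  obtain ⟨k, hk⟩ := h.even_factorization Nat.prime_five h.five_dvd
  have := Nat.prime_five.factorization_pos_of_dvd h.ne_zero h.five_dvd
  have := h.factorization_five_ne_two
  have := h.factorization_five_ne_four
  omega

lemma not_dvd_of_lt (h : IsCandidate m q r s) {t : ℕ} (ht : t.Prime) (ht5 : t ≠ 5) (hst : s < t) :
    ¬ t ∣ m := by
  intro htm
  have := h.cover t ht htm
  have := h.lt_qr
  have := h.lt_rs
  omega

lemma eight_le_factorization_five (h : IsCandidate m q r s) (hs : s < 19531) : 8 ≤ m.factorization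
    5 :=
  have p : Nat.Prime 19531 := by norm_num
  h.add_two_le_factorization 19531 Nat.prime_five (by decide) (by norm_num)
  h.six_le_factorization_five p
    (by norm_num) (by decide +kernel) (h.not_dvd_of_lt p (by norm_num) hs)

lemma not_eleven (h : IsCandidate m 11 r s) : False := by
  have hqr := h.lt_qr
  have hrs := h.lt_rs
  have hup := h.upper
  have h5 := h.six_le_factorization_five
  have h11 := h.six_le_factorization_eleven ((by norm_num : 4 ≤ 6).trans h5)
  have p11 : Nat.Prime 11 := by norm_num
  have hr2 : r < 113 := by
    by_contra hlt
    have := upper_antitone (Q := 11) (R := 113) (S := 114) (by norm_num) (by norm_num)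
      (by norm_num) le_rfl (by omega) (by omega) hup
    norm_num at this
  obtain ⟨hr, hrm, hr5⟩ := h.mem r (by simp) (by omega)
  have hr1 : 59 ≤ r := by
    have := h.powSum_mul_le_three p11 hr (by norm_num) hr5 (by omega) h5 h11
        (h.one_le_factorization hr hrm)
    simp only [powSum, Finset.sum_range_succ, Finset.sum_range_zero, pow_zero, pow_one] at this
    by_contra hlt
    exact not_prime_of_mem_Icc 54 58 (by omega) (by omega) (by decide +kernel) hr
  have hs2 : s < 1100 := by
    by_contra hlt
    have := upper_antitone (Q := 11) (R := 59) (S := 1100) (by norm_num) (by norm_num)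
      (by norm_num) le_rfl hr1 (by omega) hup
    norm_num at this
  obtain ⟨hs, hsm, hs5⟩ := h.mem s (by simp) (by omega)
  refine no_primes_with_eleven hr hs hr1 hr2 hrs hup fun k hk => ?_
  exact h.powSum_mul_le_four p11 hr hs (by norm_num) hr5 hs5 (by omega) (by omega) (by omega)
    (h.eight_le_factorization_five (by omega)) h11 (h.two_le_factorization hr hrm)
    (hk.trans (h.two_le_factorization hs hsm))

lemma not_thirteen (h : IsCandidate m 13 r s) : False := by
  have hqr := h.lt_qr
  have hrs := h.lt_rs
  have hup := h.upper
  have h5 := h.six_le_factorization_five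
  obtain ⟨p13, h13, -⟩ := h.mem 13 (by simp) (by norm_num)
  have h13' : 4 ≤ m.factorization 13 := h.add_two_le_factorization 3 p13 even_two two_ne_zero
      (h.two_le_factorization p13 h13) Nat.prime_three
    (by norm_num) (by decide +kernel) h.not_three_dvd
  have hr2 : r < 61 := by
    by_contra hlt
    have := upper_antitone (Q := 13) (R := 61) (S := 62) (by norm_num) (by norm_num)
      (by norm_num) le_rfl (by omega) (by omega) hup
    norm_num at this
  obtain ⟨hr, hrm, hr5⟩ := h.mem r (by simp) (by omega)
  have hr1 : 31 ≤ r := by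
    have := h.powSum_mul_le_three p13 hr (by norm_num) hr5 (by omega) h5 h13'
        (h.one_le_factorization hr hrm)
    simp only [powSum, Finset.sum_range_succ, Finset.sum_range_zero, pow_zero, pow_one] at this
    by_contra hlt
    exact not_prime_of_mem_Icc 30 30 (by omega) (by omega) (by decide +kernel) hr
  have hs2 : s < 2016 := by
    by_contra hlt
    have := upper_antitone (Q := 13) (R := 31) (S := 2016) (by norm_num) (by norm_num)
      (by norm_num) le_rfl hr1 (by omega) hup
    norm_num at this
  obtain ⟨hs, hsm, hs5⟩ := h.mem s (by simp) (by omega)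
  have p30941 : Nat.Prime 30941 := by norm_num
  have h13'' : 6 ≤ m.factorization 13 := h.add_two_le_factorization 30941 p13 (by decide)
      (by norm_num) h13' p30941 (by norm_num)
    (by decide +kernel) (h.not_dvd_of_lt p30941 (by norm_num) (by omega))
  have hlow {c k : ℕ} (hc : c ≤ m.factorization r) (hk : k ≤ m.factorization s) :=
      h.powSum_mul_le_four p13 hr hs (by norm_num)
    hr5 hs5 (by omega) (by omega) (by omega) (h.eight_le_factorization_five (by omega)) h13'' hc hk
  by_cases hr31 : r = 31 ∨ r = 43
  · have hr4 : 4 ≤ m.factorization r := h.add_two_le_factorization 3 hr even_two two_ne_zero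
      (h.two_le_factorization hr hrm) Nat.prime_three (by norm_num)
      (by rcases hr31 with rfl | rfl <;> decide +kernel) h.not_three_dvd
    have hlow1 := hlow hr4 (h.one_le_factorization hs hsm)
    simp only [powSum, Finset.sum_range_succ, Finset.sum_range_zero, pow_zero, pow_one] at hlow1
    obtain rfl | rfl := hr31
    · exact not_prime_of_mem_Icc 2012 2016 (by omega) (by omega) (by decide +kernel) hs
    · obtain rfl : s = 103 := by omega
      have hs4 : 4 ≤ m.factorization 103 := h.add_two_le_factorization 3 hs even_two two_ne_zero
        (h.two_le_factorization hs hsm) Nat.prime_three (by norm_num) (by decide +kernel)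
        h.not_three_dvd
      have hlow4 := hlow hr4 hs4
      norm_num [powSum, Finset.sum_range_succ] at hlow4
  · have hr37 : 37 ≤ r := by
      by_contra hlt
      exact not_prime_of_mem_Icc 32 36 (by omega) (by omega) (by decide +kernel) hr
    exact no_primes_with_thirteen hr hs hr37 hr2 (by omega) hrs hup fun k hk =>
      hlow (h.two_le_factorization hr hrm) (hk.trans (h.two_le_factorization hs hsm))

lemma not_seventeen (h : IsCandidate m 17 r s) : False := by
  have hqr := h.lt_qr
  have hrs := h.lt_rs
  have hup := h.upper
  have h5 := h.six_le_factorization_five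
  obtain ⟨p17, h17, -⟩ := h.mem 17 (by simp) (by norm_num)
  have h17' := h.two_le_factorization p17 h17
  have hr2 : r < 41 := by
    by_contra hlt
    have := upper_antitone (Q := 17) (R := 41) (S := 42) (by norm_num) (by norm_num)
      (by norm_num) le_rfl (by omega) (by omega) hup
    norm_num at this
  obtain ⟨hr, hrm, hr5⟩ := h.mem r (by simp) (by omega)
  have hr1 : 23 ≤ r := by
    obtain rfl | hr19 := eq_or_ne r 19
    · have := h.powSum_mul_le_three p17 hr (by norm_num) hr5 (by norm_num) h5 h17'
        (h.two_le_factorization hr hrm)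
      norm_num [powSum, Finset.sum_range_succ] at this
    by_contra hlt
    have : r = 18 ∨ 20 ≤ r := by omega
    obtain rfl | hr20 := this
    · norm_num at hr
    · exact not_prime_of_mem_Icc 20 22 (by omega) (by omega) (by decide +kernel) hr
  have hs2 : s < 122 := by
    by_contra hlt
    have := upper_antitone (Q := 17) (R := 23) (S := 122) (by norm_num) (by norm_num)
      (by norm_num) le_rfl hr1 (by omega) hup
    norm_num at this
  obtain ⟨hs, hsm, hs5⟩ := h.mem s (by simp) (by omega)
  refine no_primes_with_seventeen hr hs hr1 hr2 hrs hup fun k hk => ?_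
  exact h.powSum_mul_le_four p17 hr hs (by norm_num) hr5 hs5 (by omega) (by omega) (by omega)
    h5 h17' (h.two_le_factorization hr hrm) (hk.trans (h.two_le_factorization hs hsm))

lemma not_nineteen (h : IsCandidate m 19 r s) : False := by
  have hqr := h.lt_qr
  have hrs := h.lt_rs
  have hup := h.upper
  have h5 := h.six_le_factorization_five
  obtain ⟨p19, h19, -⟩ := h.mem 19 (by simp) (by norm_num)
  have h19' : 4 ≤ m.factorization 19 := h.add_two_le_factorization 3 p19 even_two two_ne_zero
      (h.two_le_factorization p19 h19) Nat.prime_three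
    (by norm_num) (by decide +kernel) h.not_three_dvd
  have hr2 : r < 37 := by
    by_contra hlt
    have := upper_antitone (Q := 19) (R := 37) (S := 38) (by norm_num) (by norm_num)
      (by norm_num) le_rfl (by omega) (by omega) hup
    norm_num at this
  obtain ⟨hr, hrm, hr5⟩ := h.mem r (by simp) (by omega)
  have hr1 : 23 ≤ r := by
    by_contra hlt
    exact not_prime_of_mem_Icc 20 22 (by omega) (by omega) (by decide +kernel) hr
  have hs2 : s < 69 := by
    by_contra hlt
    have := upper_antitone (Q := 19) (R := 23) (S := 69) (by norm_num) (by norm_num)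
      (by norm_num) le_rfl hr1 (by omega) hup
    norm_num at this
  obtain ⟨hs, hsm, hs5⟩ := h.mem s (by simp) (by omega)
  refine no_primes_with_nineteen hr hs hr1 hr2 hrs hup fun k hk => ?_
  exact h.powSum_mul_le_four p19 hr hs (by norm_num) hr5 hs5 (by omega) (by omega) (by omega)
    h5 h19' (h.two_le_factorization hr hrm) (hk.trans (h.two_le_factorization hs hsm))

end IsCandidate

lemma not_isCandidate (m q r s : ℕ) : ¬ IsCandidate m q r s := by
  intro h
  obtain rfl | rfl | rfl | rfl := h.smallest_mem
  exacts [h.not_eleven, h.not_thirteen, h.not_seventeen, h.not_nineteen]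

lemma Finset.exists_lt_lt_of_card_eq_three {T : Finset ℕ} (hT : T.card = 3) :
    ∃ q r s, q < r ∧ r < s ∧ T = {q, r, s} := by
  refine ⟨T.orderEmbOfFin hT 0, T.orderEmbOfFin hT 1, T.orderEmbOfFin hT 2, by simp, by simp, ?_⟩
  ext x
  have hx : x ∈ Set.range (T.orderEmbOfFin hT) ↔ x ∈ T := by
    rw [Finset.range_orderEmbOfFin, Finset.mem_coe]
  rw [← hx]
  simp only [Set.mem_range, Fin.exists_fin_succ, Finset.mem_insert, Finset.mem_singleton]
  simp [eq_comm]

/-- An odd number prime to `3` with abundancy index `7/5` has at least five prime divisors. -/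
lemma five_le_card_primeFactors {m : ℕ} (hm : m ≠ 0) (h2 : ¬ 2 ∣ m) (h3 : ¬ 3 ∣ m)
    (hσ : 5 * sigma 1 m = 7 * m) : 5 ≤ m.primeFactors.card := by
  by_contra hlt
  have h5 : 5 ∈ m.primeFactors := Nat.mem_primeFactors.mpr ⟨Nat.prime_five,
    (Nat.Coprime.dvd_mul_left (by norm_num : Nat.Coprime 5 7)).mp (hσ ▸ dvd_mul_right 5 _), hm⟩
  have hcard := Finset.card_erase_of_mem h5
  obtain ⟨T, hT1, hT2, hT3⟩ := Finset.exists_subsuperset_card_eq (n := 3)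
    (Finset.subset_union_left (s₁ := m.primeFactors.erase 5) (s₂ := Finset.Ico 100000 100003))
    (by omega) ((by simp : 3 ≤ (Finset.Ico 100000 100003).card).trans
      (Finset.card_le_card Finset.subset_union_right))
  obtain ⟨q, r, s, hqr, hrs, rfl⟩ := Finset.exists_lt_lt_of_card_eq_three hT3
  refine not_isCandidate m q r s ⟨hσ, hm, h2, h3, hqr, hrs, fun p hp hlt => ?_, fun p hp hpm => ?_⟩
  · have := hT2 (by simpa using hp : p ∈ ({q, r, s} : Finset ℕ))
    simp only [Finset.mem_union, Finset.mem_erase, Nat.mem_primeFactors, Finset.mem_Ico] at this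
    obtain ⟨hp5, hp, hpm, -⟩ := this.resolve_right (by omega)
    exact ⟨hp, hpm, hp5⟩
  · by_cases hp5 : p = 5
    · exact .inl hp5
    · have := hT1 (Finset.mem_erase.mpr ⟨hp5, Nat.mem_primeFactors.mpr ⟨hp, hpm, hm⟩⟩)
      exact .inr (by simpa using this)

/-- A friend of 20 has at least six distinct prime divisors. -/
theorem friend20_omega_ge_six (N : ℕ) (hN : IsFriendOf20 N) :
    6 ≤ N.primeFactors.card := by
  obtain ⟨hlt, heq⟩ := hN
  have h10 : 10 ∣ N := by omega
  have h20 : ¬ 20 ∣ N := by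
    rintro ⟨k, rfl⟩
    have := mul_sigma_lt_sigma_mul (d := 20) (k := k) (by norm_num) (by omega)
    rw [show sigma 1 20 = 42 by decide +kernel] at this
    omega
  have h3 : ¬ 3 ∣ N := by
    intro h3
    have := sigma_mul_le_of_dvd (d := 30) (m := N) (by omega) (by omega)
    rw [show sigma 1 30 = 72 by decide +kernel] at this
    omega
  obtain ⟨m, rfl⟩ : 2 ∣ N := by omega
  have hm2 : ¬ 2 ∣ m := by omega
  have hcop : Nat.Coprime 2 m := (Nat.Prime.coprime_iff_not_dvd Nat.prime_two).mpr hm2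
  rw [isMultiplicative_sigma.map_mul_of_coprime hcop,
    show sigma 1 2 = 3 by decide +kernel] at heq
  have h5 := five_le_card_primeFactors (m := m) (by omega) hm2 (by omega) (by omega)
  rw [hcop.primeFactors_mul, Finset.card_union_of_disjoint hcop.disjoint_primeFactors,
    Nat.prime_two.primeFactors, Finset.card_singleton]
  omega
end

section
/- Let N be a friend of 20 and let a be the positive integer with v₅(N) = 2a, where v₅(N) is the exponent of 5 in the prime factorization of N. Then Ω(N) ≥ 2·ω(N) + 6a − 5, where Ω(N) is the number of prime divisors of N counted with multiplicity and ω(N) is the number of distinct prime divisors of N. -/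
open ArithmeticFunction in
/-- A friend of `20` is not divisible by `20`. -/
theorem IsFriendOf20.not_twenty_dvd {N : ℕ} (hN : IsFriendOf20 N) : ¬ 20 ∣ N := by
  rintro ⟨k, rfl⟩
  obtain ⟨hlt, hsum⟩ := hN
  have hk : 1 < k := by omega
  have hinj : Set.InjOn (fun d : ℕ => d * k) (Nat.divisors 20) := by
    intro x _ y _ hxy
    exact Nat.eq_of_mul_eq_mul_right (by omega) hxy
  have hnot : 1 ∉ (Nat.divisors 20).image (fun d : ℕ => d * k) := by
    intro h
    obtain ⟨d, _, hd⟩ := Finset.mem_image.1 h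
    have := Nat.eq_one_of_mul_eq_one_left hd
    omega
  have hsub : insert 1 ((Nat.divisors 20).image (fun d : ℕ => d * k)) ⊆
      Nat.divisors (20 * k) := by
    intro x hx
    rcases Finset.mem_insert.1 hx with rfl | hx
    · exact Nat.mem_divisors.2 ⟨one_dvd _, by omega⟩
    · obtain ⟨d, hd, rfl⟩ := Finset.mem_image.1 hx
      exact Nat.mem_divisors.2 ⟨Nat.mul_dvd_mul_right (Nat.dvd_of_mem_divisors hd) k, by omega⟩
  have hle := Finset.sum_le_sum_of_subset (f := fun d : ℕ => d) hsub
  rw [Finset.sum_insert hnot, Finset.sum_image hinj, ← Finset.sum_mul,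
    show ∑ d ∈ Nat.divisors 20, d = 42 by decide] at hle
  rw [sigma_one_apply] at hsum
  omega

/-- A friend of `20` has the form `2 * m` with `m` odd and `5 * σ(m) = 7 * m`. -/
theorem IsFriendOf20.exists_odd_half {N : ℕ} (hN : IsFriendOf20 N) :
    ∃ m, N = 2 * m ∧ Odd m ∧ 5 * ArithmeticFunction.sigma 1 m = 7 * m := by
  have h20 := hN.not_twenty_dvd
  obtain ⟨_, hsum⟩ := hN
  obtain ⟨m, rfl⟩ : 2 ∣ N := by omega
  have hodd : Odd m := Nat.odd_iff.2 (by omega)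
  refine ⟨m, rfl, hodd, ?_⟩
  have hmul := ArithmeticFunction.isMultiplicative_sigma (k := 1) |>.map_mul_of_coprime
    (Nat.coprime_two_left.2 hodd)
  rw [hmul, show ArithmeticFunction.sigma 1 2 = 3 by decide] at hsum
  omega

theorem odd_geom_sum_iff {q : ℕ} (hq : Odd q) (n : ℕ) :
    Odd (∑ i ∈ Finset.range n, q ^ i) ↔ Odd n := by
  induction n with
  | zero => simp
  | succ n ih => rw [Finset.sum_range_succ, Nat.odd_add, ih]; grind [Odd.pow, Nat.not_even_iff_odd]

/-- If `5` divides `1 + q + ⋯ + q ^ (n - 1)` with `n` odd, then `q ≡ 1` modulo `5`. -/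
theorem five_dvd_sub_one_of_five_dvd_geom_sum {q n : ℕ} (hq : 2 ≤ q) (hn : Odd n)
    (h : 5 ∣ ∑ i ∈ Finset.range n, q ^ i) : 5 ∣ q - 1 := by
  have hpow : (q : ZMod 5) ^ n = 1 := by
    have hgeom := geom_sum_mul (q : ZMod 5) n
    have hzero : ∑ i ∈ Finset.range n, (q : ZMod 5) ^ i = 0 := by
      simpa using (ZMod.natCast_eq_zero_iff _ 5).2 h
    rw [hzero, zero_mul] at hgeom
    exact (sub_eq_zero.1 hgeom.symm)
  have key : ∀ x : ZMod 5, x ^ n = 1 → x = 1 := by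
    intro x hx
    have hx0 : x ≠ 0 := by
      rintro rfl
      rw [zero_pow hn.pos.ne'] at hx
      exact absurd hx (by decide)
    have hfour : x ^ 4 = 1 := by clear hx; revert x; decide
    obtain ⟨k, rfl⟩ := hn
    rw [← Nat.div_add_mod k 2, show 2 * (2 * (k / 2) + k % 2) + 1
      = 4 * (k / 2) + (2 * (k % 2) + 1) by ring, pow_add, pow_mul, hfour, one_pow, one_mul] at hx
    rcases Nat.mod_two_eq_zero_or_one k with h | h <;> rw [h] at hx <;> clear hfour hx0 <;>
      revert x <;> decide
  have := key _ hpow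
  rw [← ZMod.natCast_eq_zero_iff, Nat.cast_sub (by omega), this]
  simp

theorem two_mul_add_three_le_five_pow {t : ℕ} (ht : 1 ≤ t) : 2 * t + 3 ≤ 5 ^ t := by
  induction t, ht using Nat.le_induction with
  | base => norm_num
  | succ t _ ih => rw [pow_succ]; omega

theorem two_mul_padicValNat_geom_sum_add_two_le {q e : ℕ} (hq : 2 ≤ q) (he : Even e)
    (he0 : e ≠ 0) :
    2 * padicValNat 5 (∑ i ∈ Finset.range (e + 1), q ^ i) + 2 ≤ e := by
  have : Fact (Nat.Prime 5) := ⟨by norm_num⟩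
  have he2 : 2 ≤ e := by obtain ⟨c, rfl⟩ := he; omega
  by_cases h : 5 ∣ ∑ i ∈ Finset.range (e + 1), q ^ i
  · have hq1 := five_dvd_sub_one_of_five_dvd_geom_sum hq he.add_one h
    have hne : ∑ i ∈ Finset.range (e + 1), q ^ i ≠ 0 := (geom_sum_pos q.zero_le e.succ_ne_zero).ne'
    have hlte := padicValNat.pow_sub_pow (p := 5) (x := q) (y := 1) (by decide) (by omega) hq1
      (by omega) (n := e + 1) (by omega)
    have hgeom : (∑ i ∈ Finset.range (e + 1), q ^ i) * (q - 1) = q ^ (e + 1) - 1 ^ (e + 1) := by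
      rw [one_pow, Nat.geomSum_eq hq, Nat.div_mul_cancel (Nat.sub_one_dvd_pow_sub_one q (e + 1))]
    rw [← hgeom, padicValNat.mul hne (by omega)] at hlte
    have hval : padicValNat 5 (∑ i ∈ Finset.range (e + 1), q ^ i) = padicValNat 5 (e + 1) := by
      omega
    have hpos := one_le_padicValNat_of_dvd hne h
    have hle := Nat.le_of_dvd e.succ_pos (pow_padicValNat_dvd (p := 5) (n := e + 1))
    rw [hval] at hpos ⊢
    have := two_mul_add_three_le_five_pow hpos
    omega
  · rw [padicValNat.eq_zero_of_not_dvd h]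
    omega

theorem sigma_one_eq_prod_geom_sum {m : ℕ} (hm : m ≠ 0) :
    ArithmeticFunction.sigma 1 m =
      ∏ p ∈ m.primeFactors, ∑ i ∈ Finset.range (m.factorization p + 1), p ^ i := by
  simpa using ArithmeticFunction.sigma_eq_prod_primeFactors_sum_range_factorization_pow_mul
    (k := 1) hm

theorem even_factorization_of_odd_sigma {m : ℕ} (hm : Odd m)
    (hs : Odd (ArithmeticFunction.sigma 1 m)) {p : ℕ} (hp : p ∈ m.primeFactors) :
    Even (m.factorization p) := by
  have hpodd : Odd p := hm.of_dvd_nat (Nat.dvd_of_mem_primeFactors hp)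
  rw [sigma_one_eq_prod_geom_sum hm.pos.ne'] at hs
  have := (odd_geom_sum_iff hpodd _).1 (hs.of_dvd_nat (Finset.dvd_prod_of_mem _ hp))
  rwa [Nat.odd_add_one, Nat.not_odd_iff_even] at this

/-- If `m` and `σ(m)` are odd and `5 ∣ m`, each prime factor `p ≠ 5` of `m` uses at least
`2 * v₅(σ(p ^ vₚ(m))) + 2` of the prime factors of `m` counted with multiplicity. -/
theorem two_mul_padicValNat_sigma_add_le {m : ℕ} (hm : Odd m)
    (hs : Odd (ArithmeticFunction.sigma 1 m)) (h5 : 5 ∣ m) :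
    2 * padicValNat 5 (ArithmeticFunction.sigma 1 m) + 2 * m.primeFactors.card
      + m.factorization 5 ≤ m.primeFactorsList.length + 2 := by
  have : Fact (Nat.Prime 5) := ⟨by norm_num⟩
  have hm0 : m ≠ 0 := hm.pos.ne'
  have hmem : 5 ∈ m.primeFactors := Nat.mem_primeFactors.2 ⟨by norm_num, h5, hm0⟩
  have hval : padicValNat 5 (ArithmeticFunction.sigma 1 m) = ∑ p ∈ m.primeFactors,
      padicValNat 5 (∑ i ∈ Finset.range (m.factorization p + 1), p ^ i) := by
    simp only [← Nat.factorization_def _ (Fact.out : Nat.Prime 5)]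
    rw [sigma_one_eq_prod_geom_sum hm0, Nat.factorization_prod_apply]
    intro p hp
    exact (geom_sum_pos p.zero_le (Nat.succ_ne_zero _)).ne'
  have hfive : padicValNat 5 (∑ i ∈ Finset.range (m.factorization 5 + 1), 5 ^ i) = 0 := by
    apply padicValNat.eq_zero_of_not_dvd
    rw [Finset.sum_range_succ', pow_zero, Nat.dvd_add_right
      (Finset.dvd_sum fun i _ => dvd_pow_self 5 i.succ_ne_zero)]
    norm_num
  have hlen : m.primeFactorsList.length = ∑ p ∈ m.primeFactors, m.factorization p := by
    rw [← ArithmeticFunction.cardFactors_apply, ArithmeticFunction.cardFactors_eq_sum_factorization]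
    rfl
  have hsum : ∑ p ∈ m.primeFactors.erase 5,
      (2 * padicValNat 5 (∑ i ∈ Finset.range (m.factorization p + 1), p ^ i) + 2) ≤
      ∑ p ∈ m.primeFactors.erase 5, m.factorization p := by
    refine Finset.sum_le_sum fun p hp => ?_
    have hp' := Finset.mem_of_mem_erase hp
    have hpp := Nat.prime_of_mem_primeFactors hp'
    exact two_mul_padicValNat_geom_sum_add_two_le hpp.two_le
      (even_factorization_of_odd_sigma hm hs hp')
      (hpp.factorization_pos_of_dvd hm0 (Nat.dvd_of_mem_primeFactors hp')).ne'
  rw [Finset.sum_add_distrib, ← Finset.mul_sum, Finset.sum_const, smul_eq_mul,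
    Finset.card_erase_of_mem hmem] at hsum
  rw [← Finset.add_sum_erase _ _ hmem, hfive] at hval
  rw [← Finset.add_sum_erase _ _ hmem] at hlen
  have := Finset.card_pos.2 ⟨5, hmem⟩
  omega

/-- If `N` is a friend of 20 with `v₅(N) = 2a` (`a` a positive integer), then
`Ω(N) ≥ 2·ω(N) + 6a − 5` (stated additively to avoid truncated subtraction). -/
theorem friend20_bigOmega_lower (N : ℕ) (hN : IsFriendOf20 N) (a : ℕ) (ha : 0 < a)
    (hv : N.factorization 5 = 2 * a) :
    2 * N.primeFactors.card + 6 * a ≤ N.primeFactorsList.length + 5 := by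
  have : Fact (Nat.Prime 5) := ⟨by norm_num⟩
  obtain ⟨m, rfl, hm, hsum⟩ := hN.exists_odd_half
  have hm0 : m ≠ 0 := hm.pos.ne'
  have hs : Odd (ArithmeticFunction.sigma 1 m) := by rw [Nat.odd_iff] at hm ⊢; omega
  have hs0 := hs.pos.ne'
  have hbound := two_mul_padicValNat_sigma_add_le hm hs (by omega)
  have hv5 : m.factorization 5 = 2 * a := by
    rw [Nat.factorization_mul two_ne_zero hm0, Finsupp.add_apply,
      Nat.factorization_eq_zero_of_not_dvd (by norm_num : ¬ 5 ∣ 2), zero_add] at hv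
    exact hv
  have hval : padicValNat 5 (ArithmeticFunction.sigma 1 m) + 1 = 2 * a := by
    have h := congrArg (padicValNat 5) hsum
    rw [padicValNat.mul (by norm_num) hs0, padicValNat.mul (by norm_num) hm0, padicValNat_self,
      padicValNat.eq_zero_of_not_dvd (by norm_num : ¬ 5 ∣ 7), ← Nat.factorization_def m (by norm_num),
      hv5] at h
    omega
  have hcard : (2 * m).primeFactors.card = m.primeFactors.card + 1 := by
    rw [(Nat.coprime_two_left.2 hm).primeFactors_mul,
      Finset.card_union_of_disjoint (Nat.coprime_two_left.2 hm).disjoint_primeFactors,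
      Nat.prime_two.primeFactors, Finset.card_singleton, add_comm]
  have hlen : (2 * m).primeFactorsList.length = m.primeFactorsList.length + 1 := by
    rw [(Nat.perm_primeFactorsList_mul two_ne_zero hm0).length_eq, List.length_append,
      Nat.primeFactorsList_prime Nat.prime_two, List.length_singleton, add_comm]
  omega
end

section
/- Let N = 2·5^(2a)·m² be a friend of 20, where a and m are positive integers with m odd and coprime to 5. If Ω(m) ≤ K for a natural number K, then N < 10·6^((2^(K−2a+3) − 1)²). (Here necessarily K ≥ 2a, so the exponent K−2a+3 is a positive integer.) -/
open Finset in
/-- If the reciprocals of the values of `f` on `T` sum to at least `1 / b`, then some nonempty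
subset `S` of `T` has all its values bounded by `b * 2 ^ #S`. -/
lemma exists_subset_forall_le_mul_two_pow {ι : Type*} [DecidableEq ι] (f : ι → ℕ) {b : ℕ}
    (hb : 0 < b) (T : Finset ι) (h : (1 : ℚ) / b ≤ ∑ i ∈ T, (1 : ℚ) / f i) :
    ∃ S ⊆ T, S.Nonempty ∧ ∀ i ∈ S, f i ≤ b * 2 ^ #S := by
  by_contra! hcon
  have hb' : (0 : ℚ) < b := by exact_mod_cast hb
  have key : ∀ n, ∀ S ⊆ T, #S = n →
      ∑ i ∈ S, (1 : ℚ) / f i ≤ 1 / b * (1 - 1 / 2 ^ n) := by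
    intro n
    induction n with
    | zero =>
      intro S _ hS
      simp [card_eq_zero.1 hS]
    | succ n ih =>
      intro S hST hS
      obtain ⟨i, hi, hlt⟩ := hcon S hST (card_pos.1 (by omega))
      have hrest := ih (S.erase i) ((erase_subset _ _).trans hST)
        (by rw [card_erase_of_mem hi, hS]; rfl)
      rw [← add_sum_erase _ _ hi]
      rw [hS] at hlt
      have hlt' : (b : ℚ) * 2 ^ (n + 1) ≤ f i := by exact_mod_cast hlt.le
      have hone : (1 : ℚ) / f i ≤ 1 / (b * 2 ^ (n + 1)) :=
        one_div_le_one_div_of_le (by positivity) hlt'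
      calc _ ≤ 1 / ((b : ℚ) * 2 ^ (n + 1)) + 1 / b * (1 - 1 / 2 ^ n) := add_le_add hone hrest
        _ = _ := by field_simp; ring
  have hlast := key _ T subset_rfl rfl
  have hpos : (0 : ℚ) < 1 / b * (1 / 2 ^ #T) := by positivity
  linarith

/-- The Weierstrass product inequality. -/
lemma one_sub_sum_le_prod_one_sub {ι : Type*} (T : Finset ι) (f : ι → ℚ)
    (h0 : ∀ i ∈ T, 0 ≤ f i) (h1 : ∀ i ∈ T, f i ≤ 1) :
    1 - ∑ i ∈ T, f i ≤ ∏ i ∈ T, (1 - f i) := by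
  classical
  induction T using Finset.induction_on with
  | empty => simp
  | insert i T hi ih =>
    rw [Finset.sum_insert hi, Finset.prod_insert hi]
    simp only [Finset.mem_insert, forall_eq_or_imp] at h0 h1
    have hrest := ih h0.2 h1.2
    have hsum := Finset.sum_nonneg h0.2
    nlinarith [h0.1, h1.1, mul_nonneg h0.1 hsum,
      mul_le_mul_of_nonneg_left hrest (sub_nonneg.2 h1.1)]

lemma two_mul_mul_pow_le_pow_two_pow {B w : ℕ} (hB : 2 ≤ B) (hw : 1 ≤ w) :
    2 * (B * (B * 2 ^ w) ^ w) ≤ (2 * B) ^ 2 ^ w := by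
  have h1 : w + 1 ≤ 2 ^ w := Nat.lt_two_pow_self
  have h2 : w * w + 1 + (w + 1) ≤ 2 ^ w + 2 ^ w := by
    obtain rfl | rfl | h3 : w = 1 ∨ w = 2 ∨ 3 ≤ w := by omega
    · norm_num
    · norm_num
    · induction w, h3 using Nat.le_induction with
      | base => norm_num
      | succ w hw3 ih =>
        have := ih (by omega) Nat.lt_two_pow_self
        rw [pow_succ]
        nlinarith
  obtain ⟨r, hr⟩ := Nat.exists_eq_add_of_le h1
  calc 2 * (B * (B * 2 ^ w) ^ w) = 2 ^ (w * w + 1) * B ^ (w + 1) := by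
        rw [mul_pow, ← pow_mul]; ring
    _ ≤ 2 ^ (2 ^ w + r) * B ^ (w + 1) :=
        Nat.mul_le_mul_right _ (Nat.pow_le_pow_right two_pos (by omega))
    _ = 2 ^ 2 ^ w * 2 ^ r * B ^ (w + 1) := by rw [pow_add]
    _ ≤ 2 ^ 2 ^ w * B ^ r * B ^ (w + 1) := by gcongr
    _ = 2 ^ 2 ^ w * B ^ (w + 1 + r) := by ring
    _ = (2 * B) ^ 2 ^ w := by rw [← hr, mul_pow]

/-- The bound along one step of the descent: if passing from `b` to `c` costs at most `w` factors
of size `(b + 1) * 2 ^ w`, then the exponent grows by `2 ^ w`. -/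
lemma two_mul_add_one_le_pow_two_pow {b c w : ℕ} (hb : 0 < b) (hw : 1 ≤ w)
    (hc : c ≤ b * ((b + 1) * 2 ^ w) ^ w) : 2 * (c + 1) ≤ (2 * (b + 1)) ^ 2 ^ w := by
  refine le_trans ?_ (two_mul_mul_pow_le_pow_two_pow (by omega : 2 ≤ b + 1) hw)
  have : 1 ≤ ((b + 1) * 2 ^ w) ^ w := Nat.one_le_pow _ _ (by positivity)
  nlinarith

open Finset in
/-- Think of `q p` as the exact power of a prime `p` dividing an odd number and of `s p` as
`σ (q p)`. Here `n / d` is the abundancy index of the product of the `q p` over `B ∪ C`; the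
elements of `B` count as already bounded. -/
lemma two_mul_prod_add_one_le_pow (q s : ℕ → ℕ) (k : ℕ) :
    ∀ (d n : ℕ) (B C : Finset ℕ), 2 * #C + #B = k → Disjoint B C → 0 < d → Odd n →
      (∀ p ∈ B ∪ C, 1 < p ∧ Odd p ∧ 1 < q p ∧ Odd (q p) ∧ s p * (p - 1) + 1 = p * q p) →
      d * ((∏ p ∈ B, s p) * ∏ p ∈ C, s p) = n * ((∏ p ∈ B, q p) * ∏ p ∈ C, q p) →
      2 * (d * ((∏ p ∈ B, s p) * ∏ p ∈ C, s p) + 1) ≤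
        (2 * (d * (∏ p ∈ B, p) + 1)) ^ 2 ^ k := by
  induction k using Nat.strong_induction_on with
  | _ k ih =>
  intro d n B C hk hdisj hd hn hpq heq
  have hBpq := fun p hp => hpq p (mem_union_left C hp)
  have hCpq := fun p hp => hpq p (mem_union_right B hp)
  set b := d * ∏ p ∈ B, p with hbdef
  set a := n * ∏ p ∈ B, (p - 1) with hadef
  have hb : 0 < b := mul_pos hd (prod_pos fun p hp => by have := hBpq p hp; omega)
  have hbQ : (0 : ℚ) < b := by exact_mod_cast hb
  -- the relation in `ℚ` for a single element
  have hQ : ∀ p ∈ B ∪ C, (1 : ℚ) < p ∧ (1 : ℚ) < q p ∧ (s p : ℚ) * (p - 1) + 1 = p * q p := by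
    intro p hp
    obtain ⟨h1, -, h2, -, h3⟩ := hpq p hp
    refine ⟨by exact_mod_cast h1, by exact_mod_cast h2, ?_⟩
    have := congrArg (Nat.cast : ℕ → ℚ) h3
    push_cast [Nat.cast_sub h1.le] at this
    exact this
  have hs : ∀ p ∈ B ∪ C, q p < s p ∧ s p ≤ p * q p := by
    intro p hp
    obtain ⟨h1, -, h2, -, h3⟩ := hpq p hp
    obtain ⟨r, rfl⟩ : ∃ r, p = r + 2 := ⟨p - 2, by omega⟩
    have h4 : r + 2 - 1 = r + 1 := by omega
    rw [h4] at h3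
    constructor <;> nlinarith
  have hr : (a : ℚ) / b =
      (∏ p ∈ C, (s p : ℚ) / q p) * ∏ p ∈ B, (1 - 1 / ((p * q p : ℕ) : ℚ)) := by
    have hB1 : ∏ p ∈ B, (1 - 1 / ((p * q p : ℕ) : ℚ)) =
        (∏ p ∈ B, (s p : ℚ)) * (∏ p ∈ B, ((p - 1 : ℕ) : ℚ)) /
          ((∏ p ∈ B, (p : ℚ)) * ∏ p ∈ B, (q p : ℚ)) := by
      rw [← prod_mul_distrib, ← prod_mul_distrib, ← prod_div_distrib]
      refine prod_congr rfl fun p hp => ?_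
      obtain ⟨h1, h2, h3⟩ := hQ p (mem_union_left C hp)
      have h1' : 1 ≤ p := by exact_mod_cast h1.le
      push_cast [Nat.cast_sub h1']
      have : (p : ℚ) ≠ 0 := by positivity
      have : (q p : ℚ) ≠ 0 := by positivity
      field_simp
      linarith
    have hpB : (∏ p ∈ B, (p : ℚ)) ≠ 0 :=
      prod_ne_zero_iff.2 fun p hp => by have := hQ p (mem_union_left C hp); linarith
    have hqB : (∏ p ∈ B, (q p : ℚ)) ≠ 0 :=
      prod_ne_zero_iff.2 fun p hp => by have := hQ p (mem_union_left C hp); linarith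
    have hqC : (∏ p ∈ C, (q p : ℚ)) ≠ 0 :=
      prod_ne_zero_iff.2 fun p hp => by have := hQ p (mem_union_right B hp); linarith
    have hdQ : (d : ℚ) ≠ 0 := by positivity
    have heqQ := congrArg (Nat.cast : ℕ → ℚ) heq
    push_cast at heqQ
    rw [hB1, prod_div_distrib, hadef, hbdef]
    push_cast
    field_simp
    linear_combination (-(∏ p ∈ B, ((p - 1 : ℕ) : ℚ))) * heqQ
  have hC1 : 1 ≤ ∏ p ∈ C, (s p : ℚ) / q p := by
    refine one_le_prod fun p hp => ?_
    have hp' := mem_union_right B hp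
    rw [one_le_div (by linarith [(hQ p hp').2.1])]
    exact_mod_cast (hs p hp').1.le
  have hx : ∀ p ∈ B, (1 : ℚ) ≤ ((p * q p : ℕ) : ℚ) := fun p hp => by
    have := hBpq p hp
    exact_mod_cast Nat.mul_pos (by omega) (by omega)
  have hB0 : 0 ≤ ∏ p ∈ B, (1 - 1 / ((p * q p : ℕ) : ℚ)) := prod_nonneg fun p hp =>
    sub_nonneg.2 ((div_le_one (by linarith [hx p hp])).2 (hx p hp))
  have hB1 : ∏ p ∈ B, (1 - 1 / ((p * q p : ℕ) : ℚ)) ≤ 1 := prod_le_one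
    (fun p hp => sub_nonneg.2 ((div_le_one (by linarith [hx p hp])).2 (hx p hp)))
    (fun p hp => by
      have : (0 : ℚ) ≤ 1 / ((p * q p : ℕ) : ℚ) := by positivity
      linarith)
  rcases lt_trichotomy a b with hab | hab | hab
  · -- some of the powers `q p` with `p ∈ B` are bounded
    have hsum : (1 : ℚ) / (b + 1 : ℕ) ≤ ∑ p ∈ B, (1 : ℚ) / (p * q p : ℕ) := by
      have h1 := one_sub_sum_le_prod_one_sub B (fun p => 1 / ((p * q p : ℕ) : ℚ))
        (fun p _ => by positivity)
        (fun p hp => (div_le_one (by linarith [hx p hp])).2 (hx p hp))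
      have h2 : ∏ p ∈ B, (1 - 1 / ((p * q p : ℕ) : ℚ)) ≤ a / b := by
        rw [hr]; exact le_mul_of_one_le_left hB0 hC1
      have h3 : (a : ℚ) / b ≤ 1 - 1 / b := by
        have : (a : ℚ) + 1 ≤ b := by exact_mod_cast hab
        rw [div_le_iff₀ hbQ, sub_mul, one_div_mul_cancel hbQ.ne']
        linarith
      have h4 : (1 : ℚ) / (b + 1 : ℕ) ≤ 1 / b :=
        one_div_le_one_div_of_le hbQ (by push_cast; linarith)
      linarith
    obtain ⟨S, hSB, hSne, hS⟩ :=
      exists_subset_forall_le_mul_two_pow (fun p => p * q p) b.succ_pos B hsum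
    have hw : 1 ≤ #S := hSne.card_pos
    have hcard : #(B \ S) + #S = #B := by
      rw [card_sdiff_add_card_eq_card hSB]
    have hsB := prod_sdiff (f := s) hSB
    have hqB := prod_sdiff (f := q) hSB
    have hpB := prod_sdiff (f := fun p => p) hSB
    have hIH := ih (2 * #C + #(B \ S)) (by omega) (d * ∏ p ∈ S, s p) (n * ∏ p ∈ S, q p)
      (B \ S) C rfl (hdisj.mono_left sdiff_subset)
      (mul_pos hd (prod_pos fun p hp => by
        have := hs p (mem_union_left C (hSB hp)); omega))
      (hn.mul (prod_induction _ Odd (fun _ _ => Odd.mul) odd_one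
        fun p hp => (hBpq p (hSB hp)).2.2.2.1))
      (fun p hp => hpq p (union_subset_union_left sdiff_subset hp))
      (by rw [← hsB, ← hqB] at heq; linarith)
    have hrw : d * ((∏ p ∈ B, s p) * ∏ p ∈ C, s p) =
        d * (∏ p ∈ S, s p) * ((∏ p ∈ B \ S, s p) * ∏ p ∈ C, s p) := by
      rw [← hsB]; ring
    rw [hrw]
    refine hIH.trans ?_
    have hsle : ∏ p ∈ S, s p ≤ ((b + 1) * 2 ^ #S) ^ #S := prod_le_pow_card _ _ _ fun p hp =>
      (hs p (mem_union_left C (hSB hp))).2.trans (hS p hp)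
    have hple : ∏ p ∈ B \ S, p ≤ ∏ p ∈ B, p :=
      prod_le_prod_of_subset_of_one_le' sdiff_subset fun p hp _ => (hBpq p hp).1.le
    have hstep := two_mul_add_one_le_pow_two_pow (c := d * (∏ p ∈ S, s p) * ∏ p ∈ B \ S, p)
      hb hw (by
        calc d * (∏ p ∈ S, s p) * ∏ p ∈ B \ S, p
            ≤ d * ((b + 1) * 2 ^ #S) ^ #S * ∏ p ∈ B, p := by gcongr
          _ = b * ((b + 1) * 2 ^ #S) ^ #S := by rw [hbdef]; ring)
    calc _ ≤ ((2 * (b + 1)) ^ 2 ^ #S) ^ 2 ^ (2 * #C + #(B \ S)) := by gcongr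
      _ = _ := by rw [← pow_mul, ← pow_add, ← hk, ← hcard]; congr 2; omega
  · -- `B` is empty by parity, hence so is `C`
    obtain rfl : B = ∅ := by
      by_contra hBne
      obtain ⟨p, hp⟩ := nonempty_iff_ne_empty.2 hBne
      have hodd : Odd (d * ((∏ p ∈ B, s p) * ∏ p ∈ C, s p)) := by
        rw [heq]
        exact hn.mul ((prod_induction _ Odd (fun _ _ => Odd.mul) odd_one
          fun p hp => (hBpq p hp).2.2.2.1).mul (prod_induction _ Odd (fun _ _ => Odd.mul) odd_one
          fun p hp => (hCpq p hp).2.2.2.1))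
      have hbodd : Odd b := (Nat.odd_mul.1 hodd).1.mul
        (prod_induction _ Odd (fun _ _ => Odd.mul) odd_one fun p hp => (hBpq p hp).2.1)
      have haeven : Even a :=
        Even.mul_left (even_iff_two_dvd.2 ((even_iff_two_dvd.1
          (Nat.Odd.sub_odd (hBpq p hp).2.1 odd_one)).trans (dvd_prod_of_mem (fun p => p - 1) hp))) _
      exact Nat.not_even_iff_odd.2 hbodd (hab ▸ haeven)
    obtain rfl : C = ∅ := by
      by_contra hCne
      have hlt : ∏ p ∈ C, q p < ∏ p ∈ C, s p := prod_lt_prod_of_nonempty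
        (fun p hp => by have := hCpq p hp; omega)
        (fun p hp => (hs p (mem_union_right _ hp)).1) (nonempty_iff_ne_empty.2 hCne)
      simp only [hadef, hbdef, prod_empty, mul_one, one_mul] at hab heq
      rw [hab] at heq
      exact hlt.ne' (Nat.eq_of_mul_eq_mul_left hd heq)
    simp only [card_empty] at hk
    simp [← hk, hbdef]
  · -- some of the elements of `C` are bounded
    have hsum : (1 : ℚ) / (b + 1 : ℕ) ≤ ∑ p ∈ C, (1 : ℚ) / (p : ℕ) := by
      have hp1 : ∀ p ∈ C, (1 : ℚ) < p := fun p hp => (hQ p (mem_union_right B hp)).1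
      have h1 := one_sub_sum_le_prod_one_sub C (fun p => 1 / (p : ℚ))
        (fun p _ => by positivity)
        (fun p hp => (div_le_one (by linarith [hp1 p hp])).2 (hp1 p hp).le)
      have h2 : (a : ℚ) / b ≤ ∏ p ∈ C, (s p : ℚ) / q p := by
        rw [hr]; exact mul_le_of_le_one_right (by linarith) hB1
      have h3 : (∏ p ∈ C, (s p : ℚ) / q p) * ∏ p ∈ C, (1 - 1 / (p : ℚ)) ≤ 1 := by
        rw [← prod_mul_distrib]
        refine prod_le_one (fun p hp => ?_) (fun p hp => ?_)
        · have : 1 / (p : ℚ) ≤ 1 := (div_le_one (by linarith [hp1 p hp])).2 (hp1 p hp).le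
          exact mul_nonneg (by positivity) (by linarith)
        · obtain ⟨h4, h5, h6⟩ := hQ p (mem_union_right B hp)
          have hp0 : (0 : ℚ) < p := by linarith
          have hq0 : (0 : ℚ) < q p := by linarith
          have : (s p : ℚ) / q p * (1 - 1 / (p : ℚ)) = (s p * (p - 1)) / (p * q p) := by
            field_simp
          rw [this, div_le_one (by positivity)]
          linarith
      have h4 : 0 ≤ ∏ p ∈ C, (1 - 1 / (p : ℚ)) := prod_nonneg fun p hp =>
        sub_nonneg.2 ((div_le_one (by linarith [hp1 p hp])).2 (hp1 p hp).le)
      have h5 : ((b : ℚ) + 1) / b ≤ a / b := by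
        have : (b : ℚ) + 1 ≤ a := by exact_mod_cast hab
        gcongr
      have h6 : ((b : ℚ) + 1) / b * (1 - ∑ p ∈ C, 1 / (p : ℚ)) ≤ 1 := by
        calc _ ≤ ((b : ℚ) + 1) / b * ∏ p ∈ C, (1 - 1 / (p : ℚ)) := by gcongr
          _ ≤ (∏ p ∈ C, (s p : ℚ) / q p) * ∏ p ∈ C, (1 - 1 / (p : ℚ)) := by
            gcongr; exact h5.trans h2
          _ ≤ 1 := h3
      rw [div_mul_eq_mul_div, div_le_one hbQ] at h6
      rw [div_le_iff₀ (by positivity)]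
      push_cast
      linarith
    obtain ⟨S, hSC, hSne, hS⟩ :=
      exists_subset_forall_le_mul_two_pow (fun p => p) b.succ_pos C hsum
    have hw : 1 ≤ #S := hSne.card_pos
    have hcard : #(C \ S) + #S = #C := by
      rw [card_sdiff_add_card_eq_card hSC]
    have hdBS : Disjoint B S := hdisj.mono_right hSC
    have hun : B ∪ S ∪ (C \ S) = B ∪ C := by
      rw [union_assoc, union_sdiff_of_subset hSC]
    have hmove : ∀ f : ℕ → ℕ, (∏ p ∈ B ∪ S, f p) * ∏ p ∈ C \ S, f p =
        (∏ p ∈ B, f p) * ∏ p ∈ C, f p := fun f => by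
      rw [prod_union hdBS, ← prod_sdiff (f := f) hSC]; ring
    have hcardU := card_union_of_disjoint hdBS
    have hIH := ih (2 * #(C \ S) + #(B ∪ S)) (by omega) d n (B ∪ S) (C \ S) rfl
      (disjoint_union_left.2 ⟨hdisj.mono_right sdiff_subset, disjoint_sdiff⟩) hd hn
      (by rwa [hun]) (by rwa [hmove, hmove])
    rw [hmove] at hIH
    refine hIH.trans ?_
    have hstep := two_mul_add_one_le_pow_two_pow (c := d * ∏ p ∈ B ∪ S, p) hb hw (by
      rw [prod_union hdBS, ← mul_assoc]
      exact Nat.mul_le_mul_left _ (prod_le_pow_card _ _ _ hS))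
    calc _ ≤ ((2 * (b + 1)) ^ 2 ^ #S) ^ 2 ^ (2 * #(C \ S) + #(B ∪ S)) := by gcongr
      _ = _ := by rw [← pow_mul, ← pow_add, ← hk]; congr 2; omega

open ArithmeticFunction in
lemma sigma_one_prime_pow_mul_sub_one {p e : ℕ} (hp : p.Prime) :
    sigma 1 (p ^ e) * (p - 1) + 1 = p * p ^ e := by
  rw [sigma_one_apply_prime_pow hp, Nat.geomSum_eq hp.two_le,
    Nat.div_mul_cancel (by simpa using Nat.sub_dvd_pow_sub_pow p 1 (e + 1)), ← pow_succ']
  exact Nat.sub_add_cancel (Nat.one_le_pow _ _ hp.pos)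

open ArithmeticFunction in
/-- An upper bound, in the style of Heath-Brown, for odd numbers of given abundancy index and given
number of prime factors. -/
theorem two_mul_mul_sigma_add_one_le_pow {M d n : ℕ} (hM : Odd M) (hd : 0 < d) (hn : Odd n)
    (h : d * sigma 1 M = n * M) :
    2 * (d * sigma 1 M + 1) ≤ (2 * (d + 1)) ^ 2 ^ (2 * M.primeFactors.card) := by
  have hM0 : M ≠ 0 := hM.pos.ne'
  have hσ : sigma 1 M = ∏ p ∈ M.primeFactors, sigma 1 (p ^ M.factorization p) :=
    isMultiplicative_sigma.multiplicative_factorization _ hM0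
  have hprod : ∏ p ∈ M.primeFactors, p ^ M.factorization p = M :=
    Nat.prod_factorization_pow_eq_self hM0
  have key := two_mul_prod_add_one_le_pow (fun p => p ^ M.factorization p)
    (fun p => sigma 1 (p ^ M.factorization p)) (2 * M.primeFactors.card) d n ∅ M.primeFactors
    (by simp) (Finset.disjoint_empty_left _) hd hn (fun p hp => by
      rw [Finset.empty_union] at hp
      have hpp := Nat.prime_of_mem_primeFactors hp
      have hpodd : Odd p := hM.of_dvd_nat (Nat.dvd_of_mem_primeFactors hp)
      exact ⟨hpp.one_lt, hpodd, Nat.one_lt_pow (Finsupp.mem_support_iff.1 hp) hpp.one_lt,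
        hpodd.pow, sigma_one_prime_pow_mul_sub_one hpp⟩)
    (by simpa [← hσ, hprod] using h)
  simpa [← hσ] using key

open ArithmeticFunction in
lemma padicValNat_five_sigma_prime_pow_lt {p e : ℕ} (hp : p.Prime) (he : 0 < e) :
    padicValNat 5 (sigma 1 (p ^ (2 * e))) < e := by
  have : Fact (Nat.Prime 5) := ⟨by norm_num⟩
  have hgeom := sigma_one_prime_pow_mul_sub_one (e := 2 * e) hp
  rw [← pow_succ'] at hgeom
  have hσ0 : sigma 1 (p ^ (2 * e)) ≠ 0 := by
    intro h0
    rw [h0, zero_mul, zero_add] at hgeom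
    exact (Nat.one_lt_pow (by omega) hp.one_lt).ne hgeom
  by_cases h5 : p % 5 = 1
  · have hp1 := hp.one_lt
    have hval := padicValNat.pow_sub_pow (p := 5) (by decide) hp1 (by omega) (by omega)
      (n := 2 * e + 1) (by omega)
    rw [one_pow, ← hgeom, Nat.add_sub_cancel, padicValNat.mul hσ0 (by omega)] at hval
    have hlt : 2 * e + 1 < 5 ^ e := by
      clear hval hgeom hσ0
      induction e, he using Nat.le_induction with
      | base => norm_num
      | succ e he ih => rw [pow_succ]; omega
    have hle : 5 ^ padicValNat 5 (2 * e + 1) ≤ 2 * e + 1 :=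
      Nat.le_of_dvd (by omega) pow_padicValNat_dvd
    have := (Nat.pow_lt_pow_iff_right (by norm_num : 1 < 5)).1 (hle.trans_lt hlt)
    omega
  · rw [padicValNat.eq_zero_of_not_dvd]
    · exact he
    · intro hdvd
      have hmod : p ^ (2 * e + 1) % 5 = 1 := by
        obtain ⟨c, hc⟩ := hdvd
        rw [← hgeom, hc, mul_assoc]
        omega
      have hsq : (p ^ 2) ^ e % 5 = (p ^ 2 % 5) ^ e % 5 := Nat.pow_mod _ _ _
      have hone : (4 : ℕ) ^ e % 5 = 1 ∨ (4 : ℕ) ^ e % 5 = 4 := by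
        clear * -
        induction e with
        | zero => simp
        | succ e ih => rw [pow_succ]; omega
      rw [pow_succ, pow_mul, Nat.mul_mod, hsq, Nat.pow_mod p 2] at hmod
      have hlt : p % 5 < 5 := Nat.mod_lt _ (by norm_num)
      generalize p % 5 = r at *
      interval_cases r
      · simp at hmod
      · omega
      · norm_num at hmod; omega
      · norm_num at hmod; omega
      · norm_num at hmod

open ArithmeticFunction in
lemma padicValNat_five_sigma_sq_add_card_le {m : ℕ} (hm : m ≠ 0) :
    padicValNat 5 (sigma 1 (m ^ 2)) + m.primeFactors.card ≤ m.primeFactorsList.length := by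
  have : Fact (Nat.Prime 5) := ⟨by norm_num⟩
  have hσ : sigma 1 (m ^ 2) =
      ∏ p ∈ m.primeFactors, sigma 1 (p ^ (2 * m.factorization p)) := by
    rw [isMultiplicative_sigma.multiplicative_factorization _ (pow_ne_zero 2 hm), Finsupp.prod,
      Nat.support_factorization, Nat.primeFactors_pow _ two_ne_zero]
    simp [Nat.factorization_pow]
  have hne : ∀ p ∈ m.primeFactors, sigma 1 (p ^ (2 * m.factorization p)) ≠ 0 := fun p hp =>
    sigma_eq_zero.not.2 (pow_ne_zero _ (Nat.prime_of_mem_primeFactors hp).ne_zero)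
  have hval : padicValNat 5 (sigma 1 (m ^ 2)) =
      ∑ p ∈ m.primeFactors, padicValNat 5 (sigma 1 (p ^ (2 * m.factorization p))) := by
    rw [hσ, ← Nat.factorization_def _ (by norm_num), Nat.factorization_prod_apply hne]
    exact Finset.sum_congr rfl fun p _ => Nat.factorization_def _ (by norm_num)
  have hlen : m.primeFactorsList.length = ∑ p ∈ m.primeFactors, m.factorization p := by
    rw [← cardFactors_apply, cardFactors_eq_sum_factorization]; rfl
  rw [hval, hlen, Finset.card_eq_sum_ones, ← Finset.sum_add_distrib]
  exact Finset.sum_le_sum fun p hp =>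
    padicValNat_five_sigma_prime_pow_lt (Nat.prime_of_mem_primeFactors hp)
      (Nat.pos_of_ne_zero (Finsupp.mem_support_iff.1 hp))

/-- If `N = 2·5^(2a)·m²` is a friend of 20 and `Ω(m) ≤ K`, then
`N < 10·6^((2^(K−2a+3) − 1)²)`. -/
theorem friend20_upper_bound (N a m K : ℕ) (ha : 0 < a) (hm : 0 < m)
    (hmodd : Odd m) (hm5 : Nat.Coprime m 5)
    (hform : N = 2 * 5 ^ (2 * a) * m ^ 2) (hN : IsFriendOf20 N)
    (hK : m.primeFactorsList.length ≤ K) :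
    N < 10 * 6 ^ ((2 ^ (K - 2 * a + 3) - 1) ^ 2) := by
  have : Fact (Nat.Prime 5) := ⟨by norm_num⟩
  have hp5 : Nat.Prime 5 := by norm_num
  set M := 5 ^ (2 * a) * m ^ 2 with hMdef
  have hNM : N = 2 * M := by rw [hform, hMdef, mul_assoc]
  have hModd : Odd M := (Odd.pow (by decide)).mul hmodd.pow
  have hcop : Nat.Coprime (5 ^ (2 * a)) (m ^ 2) := Nat.Coprime.pow _ _ hm5.symm
  have hσN : ArithmeticFunction.sigma 1 N = 3 * ArithmeticFunction.sigma 1 M := by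
    rw [hNM, ArithmeticFunction.isMultiplicative_sigma.map_mul_of_coprime
      (Nat.coprime_two_left.2 hModd)]
    rfl
  have hM : 5 * ArithmeticFunction.sigma 1 M = 7 * M := by
    have := hN.2
    rw [hσN, hNM] at this
    omega
  have hσM : ArithmeticFunction.sigma 1 M =
      ArithmeticFunction.sigma 1 (5 ^ (2 * a)) * ArithmeticFunction.sigma 1 (m ^ 2) :=
    ArithmeticFunction.isMultiplicative_sigma.map_mul_of_coprime hcop
  have hval : 2 * a - 1 ≤ padicValNat 5 (ArithmeticFunction.sigma 1 (m ^ 2)) := by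
    have hσ0 : ArithmeticFunction.sigma 1 (m ^ 2) ≠ 0 :=
      ArithmeticFunction.sigma_eq_zero.not.2 (pow_ne_zero 2 hm.ne')
    rw [← padicValNat_dvd_iff_le hσ0]
    have hcop5 : Nat.Coprime (5 ^ (2 * a - 1)) (ArithmeticFunction.sigma 1 (5 ^ (2 * a))) := by
      refine Nat.Coprime.pow_left _ ((Nat.Prime.coprime_iff_not_dvd hp5).2 fun hdvd => ?_)
      have hgeom := sigma_one_prime_pow_mul_sub_one (e := 2 * a) hp5
      omega
    refine hcop5.dvd_of_dvd_mul_left ⟨7 * m ^ 2, ?_⟩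
    refine Nat.eq_of_mul_eq_mul_left (by norm_num : 0 < 5) ?_
    rw [← hσM, hM, hMdef, ← mul_assoc 5, ← pow_succ', Nat.sub_add_cancel (by omega)]
    ring
  have hΩ := padicValNat_five_sigma_sq_add_card_le hm.ne'
  have hω : m.primeFactors.card ≠ 0 := by
    intro h0
    have hm1 : m = 1 := by
      rcases Nat.primeFactors_eq_empty.1 (Finset.card_eq_zero.1 h0) with h | h <;> omega
    subst hm1
    simp at hval
    omega
  have hcardM : M.primeFactors.card = 1 + m.primeFactors.card := by
    rw [hMdef, hcop.primeFactors_mul, Finset.card_union_of_disjoint hcop.disjoint_primeFactors,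
      Nat.primeFactors_prime_pow (by omega) hp5, Nat.primeFactors_pow _ two_ne_zero,
      Finset.card_singleton]
  have hbound := two_mul_mul_sigma_add_one_le_pow hModd (by norm_num) (by decide) hM
  set j := M.primeFactors.card
  have hjK : j + 1 ≤ K - 2 * a + 3 := by omega
  have hexp : 2 * 2 ^ (2 * j) ≤ (2 ^ (K - 2 * a + 3) - 1) ^ 2 := by
    calc 2 * 2 ^ (2 * j) ≤ (2 ^ (j + 1) - 1) ^ 2 := by
          have hj2 : 2 ≤ 2 ^ j := Nat.le_self_pow (by omega) 2
          obtain ⟨r, hr⟩ := Nat.exists_eq_add_of_le hj2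
          rw [pow_mul', pow_succ _ j, hr, show (2 + r) * 2 - 1 = 2 * r + 3 by omega]
          nlinarith
      _ ≤ _ := by gcongr; norm_num
  calc N < 2 * (5 * ArithmeticFunction.sigma 1 M + 1) := by omega
    _ ≤ 12 ^ 2 ^ (2 * j) := hbound
    _ ≤ (6 ^ 2) ^ 2 ^ (2 * j) := by gcongr; norm_num
    _ = 6 ^ (2 * 2 ^ (2 * j)) := by rw [← pow_mul]
    _ ≤ 6 ^ ((2 ^ (K - 2 * a + 3) - 1) ^ 2) := by gcongr; norm_num
    _ ≤ _ := Nat.le_mul_of_pos_left _ (by norm_num)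
end

section
/- If N is a friend of 20 and N = 2·F² for a positive integer F, then F is not squarefree. -/
open ArithmeticFunction in
/-- Splitting a prime `p` off a squarefree number `p * m` in `σ ((p * m) ^ 2)`. -/
theorem sigma_one_sq_prime_mul {p m : ℕ} (hp : p.Prime) (h : Squarefree (p * m)) :
    sigma 1 ((p * m) ^ 2) = (1 + p + p ^ 2) * sigma 1 (m ^ 2) := by
  have hc : (p ^ 2).Coprime (m ^ 2) := (Nat.coprime_of_squarefree_mul h).pow 2 2
  rw [mul_pow, isMultiplicative_sigma.map_mul_of_coprime hc, sigma_one_apply_prime_pow hp]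
  simp [Finset.sum_range_succ]

theorem le_sigma_one {n : ℕ} (hn : n ≠ 0) : n ≤ ArithmeticFunction.sigma 1 n := by
  rw [ArithmeticFunction.sigma_one_apply]
  exact Finset.single_le_sum (f := fun d => d) (fun _ _ => Nat.zero_le _)
    (Nat.mem_divisors_self n hn)

/-- If `a * σ(m²) = b * m²` with `m` squarefree and `p ∣ m` prime, then every prime `q` dividing
`1 + p + p²` but not `b` divides `m`. -/
theorem prime_dvd_of_mul_sigma_sq_eq {a b m p q : ℕ} (hm : Squarefree m)
    (h : a * ArithmeticFunction.sigma 1 (m ^ 2) = b * m ^ 2) (hp : p.Prime) (hpm : p ∣ m)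
    (hq : q.Prime) (hqp : q ∣ 1 + p + p ^ 2) (hqb : ¬ q ∣ b) : q ∣ m := by
  obtain ⟨k, rfl⟩ := hpm
  rw [sigma_one_sq_prime_mul hp hm] at h
  have hd : q ∣ b * (p * k) ^ 2 := h ▸ (hqp.mul_right _).mul_left a
  exact hq.dvd_of_dvd_pow ((hq.dvd_mul.mp hd).resolve_left hqb)

/-- The primes `5`, `31`, `3` successively divide `m`, and `σ(9) / 9` is already too large. -/
theorem mul_sigma_sq_ne {a b m : ℕ} (hm : Squarefree m) (h5a : 5 ∣ a) (h5 : ¬ 5 ∣ b)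
    (h31 : ¬ 31 ∣ b) (h3 : ¬ 3 ∣ b) (hab : 9 * b < 13 * a) :
    a * ArithmeticFunction.sigma 1 (m ^ 2) ≠ b * m ^ 2 := by
  intro h
  have p5 : Nat.Prime 5 := by norm_num
  have p31 : Nat.Prime 31 := by norm_num
  have hd5 : 5 ∣ m :=
    p5.dvd_of_dvd_pow ((p5.dvd_mul.mp (h ▸ h5a.mul_right _)).resolve_left h5)
  have hd31 : 31 ∣ m := prime_dvd_of_mul_sigma_sq_eq hm h p5 hd5 p31 (by norm_num) h31
  obtain ⟨k, rfl⟩ : 3 ∣ m :=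
    prime_dvd_of_mul_sigma_sq_eq hm h p31 hd31 Nat.prime_three (by norm_num) h3
  rw [sigma_one_sq_prime_mul Nat.prime_three hm] at h
  have hk : k ≠ 0 := fun hk => hm.ne_zero (by simp [hk])
  have hk2 : 0 < k ^ 2 := by positivity
  have hle := le_sigma_one hk2.ne'
  nlinarith [Nat.mul_le_mul_left (13 * a) hle, Nat.mul_lt_mul_of_pos_right hab hk2]

/-- If a friend `N` of 20 equals `2·F²`, then `F` is not squarefree. -/
theorem friend20_not_squarefree (N F : ℕ) (hF : 0 < F) (hN : IsFriendOf20 N)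
    (hform : N = 2 * F ^ 2) : ¬ Squarefree F := by
  intro hsq
  obtain ⟨-, h⟩ := hN
  subst hform
  have hmul := ArithmeticFunction.isMultiplicative_sigma (k := 1)
  by_cases h2 : 2 ∣ F
  · obtain ⟨m, rfl⟩ := h2
    have hc : Nat.Coprime (2 ^ 3) (m ^ 2) := (Nat.coprime_of_squarefree_mul hsq).pow 3 2
    have hs : ArithmeticFunction.sigma 1 (2 ^ 3) = 15 := by decide +kernel
    rw [show 2 * (2 * m) ^ 2 = 2 ^ 3 * m ^ 2 by ring, hmul.map_mul_of_coprime hc, hs] at h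
    exact mul_sigma_sq_ne (a := 25) (b := 28) hsq.of_mul_right (by norm_num) (by norm_num)
      (by norm_num) (by norm_num) (by norm_num) (by linarith)
  · have hc : Nat.Coprime 2 (F ^ 2) :=
      ((Nat.Prime.coprime_iff_not_dvd Nat.prime_two).mpr h2).pow_right 2
    have hs : ArithmeticFunction.sigma 1 2 = 3 := by decide +kernel
    rw [hmul.map_mul_of_coprime hc, hs] at h
    exact mul_sigma_sq_ne (a := 5) (b := 7) hsq (by norm_num) (by norm_num)
      (by norm_num) (by norm_num) (by norm_num) (by linarith)
end

section
/- If N is a friend of 20, then 2 exactly divides N, i.e. 2 ∣ N but 4 ∤ N (equivalently v₂(N) = 1). -/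
/-- A proper multiple of a positive integer has strictly larger abundancy index. -/
theorem mul_sigma_one_lt_sigma_one_mul_s7 {k n : ℕ} (hk : 1 < k) (hn : n ≠ 0) :
    k * ArithmeticFunction.sigma 1 n < ArithmeticFunction.sigma 1 (n * k) := by
  have hk0 : k ≠ 0 := by omega
  have hinj : Set.InjOn (k * ·) (n.divisors : Set ℕ) :=
    (mul_right_injective₀ hk0).injOn
  rw [ArithmeticFunction.sigma_one_apply, ArithmeticFunction.sigma_one_apply, Finset.mul_sum,
    ← Finset.sum_image (f := fun d => d) hinj]
  refine Finset.sum_lt_sum_of_subset (i := 1) ?_ ?_ ?_ Nat.one_pos fun _ _ _ => Nat.zero_le _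
  · intro d hd
    obtain ⟨e, he, rfl⟩ := Finset.mem_image.1 hd
    rw [Nat.mem_divisors, mul_comm n k]
    exact ⟨Nat.mul_dvd_mul_left k (Nat.dvd_of_mem_divisors he), Nat.mul_ne_zero hk0 hn⟩
  · exact Nat.one_mem_divisors.2 (Nat.mul_ne_zero hn hk0)
  · intro h
    obtain ⟨e, -, he⟩ := Finset.mem_image.1 h
    exact hk.ne' (Nat.eq_one_of_mul_eq_one_right he)

/-- If `N` is a friend of 20 then `2` exactly divides `N`: `2 ∣ N` but `4 ∤ N`. -/
theorem friend20_two_exactly_divides (N : ℕ) (hN : IsFriendOf20 N) :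
    2 ∣ N ∧ ¬ (4 ∣ N) := by
  obtain ⟨hlt, heq⟩ := hN
  refine ⟨by omega, fun h4 => ?_⟩
  obtain ⟨k, rfl⟩ : 20 ∣ N := by omega
  have h := mul_sigma_one_lt_sigma_one_mul_s7 (k := k) (n := 20) (by omega) (by norm_num)
  have h20 : ArithmeticFunction.sigma 1 20 = 42 := by decide
  rw [h20] at h
  omega
end

section
/- If N is a friend of 20, then N is coprime to 21; that is, 3 ∤ N and 7 ∤ N. -/
/-- The abundancy index `σ(n)/n` is monotone along divisibility: `σ(d)/d ≤ σ(dk)/(dk)`. -/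
theorem sigma_one_mul_le (d k : ℕ) (hd : d ≠ 0) (hk : k ≠ 0) :
    ArithmeticFunction.sigma 1 d * k ≤ ArithmeticFunction.sigma 1 (d * k) := by
  rw [ArithmeticFunction.sigma_one_apply, ArithmeticFunction.sigma_one_apply, Finset.sum_mul,
    ← Finset.sum_image (s := d.divisors) (g := fun e => e * k) (f := fun e => e)
      (fun a _ b _ h => Nat.eq_of_mul_eq_mul_right (Nat.pos_of_ne_zero hk) h)]
  refine Finset.sum_le_sum_of_subset fun e he => ?_
  obtain ⟨c, hc, rfl⟩ := Finset.mem_image.mp he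
  exact Nat.mem_divisors.mpr
    ⟨mul_dvd_mul_right (Nat.dvd_of_mem_divisors hc) k, mul_ne_zero hd hk⟩

/-- A divisor of a friend of `20` has abundancy index at most `21/10`. -/
theorem IsFriendOf20.sigma_one_le_of_dvd {N d : ℕ} (hN : IsFriendOf20 N) (h : d ∣ N) :
    10 * ArithmeticFunction.sigma 1 d ≤ 21 * d := by
  obtain ⟨hlt, hσ⟩ := hN
  obtain ⟨k, rfl⟩ := h
  have hd : d ≠ 0 := by rintro rfl; simp at hlt
  have hk : k ≠ 0 := by rintro rfl; simp at hlt
  have := sigma_one_mul_le d k hd hk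
  refine Nat.le_of_mul_le_mul_right ?_ (Nat.pos_of_ne_zero hk)
  linarith

theorem IsFriendOf20.ten_dvd {N : ℕ} (hN : IsFriendOf20 N) : 10 ∣ N := by
  have := hN.2
  omega

theorem IsFriendOf20.not_three_dvd {N : ℕ} (hN : IsFriendOf20 N) : ¬ 3 ∣ N := by
  intro h
  have h10 := hN.ten_dvd
  have hle := hN.sigma_one_le_of_dvd (d := 30) (by omega)
  have hσ : ArithmeticFunction.sigma 1 30 = 72 := by decide +kernel
  rw [hσ] at hle
  norm_num at hle

theorem IsFriendOf20.not_seven_dvd {N : ℕ} (hN : IsFriendOf20 N) : ¬ 7 ∣ N := by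
  intro h
  have h10 := hN.ten_dvd
  have h4 : ¬ 4 ∣ N := fun h4 => by
    have hle := hN.sigma_one_le_of_dvd (d := 140) (by omega)
    have hσ : ArithmeticFunction.sigma 1 140 = 336 := by decide +kernel
    rw [hσ] at hle
    norm_num at hle
  have h25 : ¬ 25 ∣ N := fun h25 => by
    have hle := hN.sigma_one_le_of_dvd (d := 350) (by clear h4; omega)
    have hσ : ArithmeticFunction.sigma 1 350 = 744 := by decide +kernel
    rw [hσ] at hle
    norm_num at hle
  obtain ⟨K, rfl⟩ := h10
  have hcop : Nat.Coprime 10 K :=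
    Nat.Coprime.mul_left (m := 2) (n := 5)
      ((Nat.Prime.coprime_iff_not_dvd Nat.prime_two).mpr (by omega))
      ((Nat.Prime.coprime_iff_not_dvd Nat.prime_five).mpr (by omega))
  have hσ := hN.2
  have hten : ArithmeticFunction.sigma 1 10 = 18 := by decide +kernel
  rw [ArithmeticFunction.isMultiplicative_sigma.map_mul_of_coprime hcop, hten] at hσ
  omega

/-- A friend of 20 is coprime to 21, i.e. `3 ∤ N` and `7 ∤ N`. -/
theorem friend20_coprime_21 (N : ℕ) (hN : IsFriendOf20 N) :
    Nat.Coprime N 21 ∧ ¬ (3 ∣ N) ∧ ¬ (7 ∣ N) :=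
  ⟨Nat.Coprime.mul_right (m := 3) (n := 7)
      ((Nat.Prime.coprime_iff_not_dvd Nat.prime_three).mpr hN.not_three_dvd).symm
      ((Nat.Prime.coprime_iff_not_dvd Nat.prime_seven).mpr hN.not_seven_dvd).symm,
    hN.not_three_dvd, hN.not_seven_dvd⟩
end
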